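/- arXiv:2109.01022 — 2 statements merged into one kernel-verified Lean document; each statement's English description precedes it below -/
import Mathlib

section
/- Let B be the open unit ball of ℝ² and partition it (up to a null set) into the four open sectors Ω₁ = {x ∈ B : x₂ > |x₁|}, Ω₂ = {x ∈ B : x₁ < −|x₂|}, Ω₃ = {x ∈ B : x₂ < −|x₁|}, Ω₄ = {x ∈ B : x₁ > |x₂|}. Then for F ∈ ℝ^{2×2} the following are equivalent: (i) F ∈ SO(2); (ii) there exists a Lipschitz map u from the closed unit ball of ℝ² to ℝ² such that u(x) = F x for every x with ‖x‖ = 1, and u is differentiable at almost every point of B with its derivative (as a 2×2 matrix) belonging to 𝓜_{e1} at almost every x ∈ Ω₁ ∪ Ω₃ and to 𝓜_{e2} at almost every x ∈ Ω₂ ∪ Ω₄. -/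
open Matrix Real Set MeasureTheory

noncomputable section

/-- The space of real 2×2 matrices. -/
abbrev M2 : Type := Matrix (Fin 2) (Fin 2) ℝ

/-- Euclidean norm on ℝ². -/
def enorm2 (v : Fin 2 → ℝ) : ℝ := Real.sqrt ((v 0) ^ 2 + (v 1) ^ 2)

/-- Rotation matrix by angle θ. -/
def rot (θ : ℝ) : M2 := !![Real.cos θ, -Real.sin θ; Real.sin θ, Real.cos θ]

/-- The set of rotations SO(2). -/
def SO2 : Set M2 := {R : M2 | ∃ θ : ℝ, R = rot θ}

def e1 : Fin 2 → ℝ := ![1, 0]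
def e2 : Fin 2 → ℝ := ![0, 1]

/-- Perpendicular vector w⊥ = (−w₂, w₁). -/
def perp (w : Fin 2 → ℝ) : Fin 2 → ℝ := ![-(w 1), w 0]

/-- 𝓜_s = {F : det F = 1 and ‖F s‖ = 1}. -/
def calM (s : Fin 2 → ℝ) : Set M2 := {F : M2 | F.det = 1 ∧ enorm2 (F.mulVec s) = 1}

/-- 𝓝_s = {F : det F = 1 and ‖F s‖ ≤ 1}. -/
def calN (s : Fin 2 → ℝ) : Set M2 := {F : M2 | F.det = 1 ∧ enorm2 (F.mulVec s) ≤ 1}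

/-- The derivative of a map ℝ² → ℝ² at a point, as a 2×2 matrix. -/
def gradMatrix (u : (Fin 2 → ℝ) → Fin 2 → ℝ) (x : Fin 2 → ℝ) : M2 :=
  LinearMap.toMatrix' ((fderiv ℝ u x).toLinearMap)


abbrev E2 : Type := Fin 2 → ℝ

open scoped Topology NNReal
open Filter

lemma lineDeriv_integrable {f : E2 → ℝ} {C : ℝ≥0} (hf : LipschitzWith C f)
    (h : HasCompactSupport f) (v : E2) :
    Integrable (fun x => lineDeriv ℝ f x v) volume := by
  have h1 := (hf.locallyIntegrable_lineDeriv (μ := volume) v).integrableOn_isCompact h.isCompact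
  rw [integrableOn_iff_integrable_of_support_subset] at h1
  · exact h1
  · intro x hx
    by_contra hx'
    apply hx
    have : f =ᶠ[𝓝 x] fun _ => 0 := by
      have := (isClosed_tsupport f).isOpen_compl.mem_nhds hx'
      filter_upwards [this] with y hy
      exact image_eq_zero_of_notMem_tsupport hy
    simp only
    rw [this.lineDeriv_eq]
    simp [lineDeriv]

lemma lineDeriv_translate (f : E2 → ℝ) (a x w : E2) :
    lineDeriv ℝ (fun y => f (y + a)) x w = lineDeriv ℝ f (x + a) w := by
  simp only [lineDeriv]
  congr 1
  funext t
  congr 1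
  abel

lemma lip_translate {f : E2 → ℝ} {C : ℝ≥0} (hf : LipschitzWith C f) (a : E2) :
    LipschitzWith C (fun y => f (y + a)) := by
  intro x y
  have := hf (x + a) (y + a)
  simpa using this

lemma cs_translate {f : E2 → ℝ} (hf : HasCompactSupport f) (a : E2) :
    HasCompactSupport (fun y => f (y + a)) :=
  hf.comp_homeomorph (Homeomorph.addRight a)

lemma integ_mul {f g : E2 → ℝ} {C : ℝ≥0} (hf : LipschitzWith C f)
    (hg : Integrable g volume) (hc : HasCompactSupport f) :
    Integrable (fun x => f x * g x) volume := by
  obtain ⟨M, hM⟩ := hc.exists_bound_of_continuous hf.continuous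
  exact hg.bdd_mul hf.continuous.aestronglyMeasurable (Eventually.of_forall hM)

lemma null_lagrangian {f g : E2 → ℝ} {C D : ℝ≥0} (hf : LipschitzWith C f)
    (hg : LipschitzWith D g) (hfc : HasCompactSupport f) (hgc : HasCompactSupport g) (v w : E2) :
    ∫ x, lineDeriv ℝ f x v * lineDeriv ℝ g x w = ∫ x, lineDeriv ℝ f x w * lineDeriv ℝ g x v := by
  have A := hf.integral_inv_smul_sub_mul_tendsto_integral_lineDeriv_mul
    (lineDeriv_integrable hg hgc w) v
  have B := hg.integral_inv_smul_sub_mul_tendsto_integral_lineDeriv_mul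
    (lineDeriv_integrable hf hfc (-w)) (-v)
  have key : ∀ a : E2, ∫ x, f (x + a) * lineDeriv ℝ g x w
      = ∫ x, g (x + -a) * lineDeriv ℝ f x (-w) := by
    intro a
    have h1 := hg.integral_lineDeriv_mul_eq (μ := volume) (lip_translate hf a) (cs_translate hfc a) w
    simp only [lineDeriv_translate] at h1
    simp_rw [mul_comm (f _)]
    rw [h1, ← integral_add_right_eq_self _ (-a)]
    simp [mul_comm]
  have S : ∀ t : ℝ, ∫ x, (t⁻¹ • (f (x + t • v) - f x)) * lineDeriv ℝ g x w =
      ∫ x, (t⁻¹ • (g (x + t • (-v)) - g x)) * lineDeriv ℝ f x (-w) := by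
    intro t
    have k1 := key (t • v)
    have k0 := key 0
    simp only [neg_zero, add_zero] at k0
    simp only [smul_eq_mul, mul_assoc, integral_const_mul, sub_mul]
    rw [integral_sub, integral_sub, k1, k0, smul_neg]
    · exact integ_mul (lip_translate hg _) (lineDeriv_integrable hf hfc (-w)) (cs_translate hgc _)
    · exact integ_mul hg (lineDeriv_integrable hf hfc (-w)) hgc
    · exact integ_mul (lip_translate hf _) (lineDeriv_integrable hg hgc w) (cs_translate hfc _)
    · exact integ_mul hf (lineDeriv_integrable hg hgc w) hfc
  simp only [S] at A
  rw [tendsto_nhds_unique A B]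
  simp [lineDeriv_neg, mul_comm]

lemma integral_lineDeriv_zero {f : E2 → ℝ} {C : ℝ≥0} (hf : LipschitzWith C f)
    (hfc : HasCompactSupport f) (v : E2) : ∫ x, lineDeriv ℝ f x v = 0 := by
  have := (LipschitzWith.const (α := E2) (1:ℝ)).integral_lineDeriv_mul_eq (μ := volume) hf hfc (-v)
  simp only [neg_neg, mul_one] at this
  rw [← this]
  simp [lineDeriv]

lemma lineDeriv_mul_integrable {f g : E2 → ℝ} {C D : ℝ≥0} (hf : LipschitzWith C f)
    (hg : LipschitzWith D g) (hgc : HasCompactSupport g) (v w : E2) :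
    Integrable (fun x => lineDeriv ℝ f x v * lineDeriv ℝ g x w) volume := by
  refine (lineDeriv_integrable hg hgc w).bdd_mul (c := C * ‖v‖)
    (aestronglyMeasurable_lineDeriv hf.continuous _)
    (Eventually.of_forall fun x => norm_lineDeriv_le_of_lipschitz ℝ hf)

/-- If `f` vanishes off the open ball, all line derivatives vanish off the open ball. -/
lemma lineDeriv_outside {f : E2 → ℝ} (hf : ∀ x, 1 ≤ x 0 ^ 2 + x 1 ^ 2 → f x = 0)
    (x v : E2) (hx : 1 ≤ x 0 ^ 2 + x 1 ^ 2) : lineDeriv ℝ f x v = 0 := by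
  by_cases h : LineDifferentiableAt ℝ f x v
  · have hd := h.hasLineDerivAt
    rcases le_total 0 (x 0 * v 0 + x 1 * v 1) with hp | hp
    · have := hd.tendsto_slope_zero_right
      refine tendsto_nhds_unique this (tendsto_const_nhds.congr' ?_)
      filter_upwards [self_mem_nhdsWithin] with t (ht : 0 < t)
      rw [hf x hx, hf (x + t • v)]
      · simp
      · simp only [Pi.add_apply, Pi.smul_apply, smul_eq_mul]
        nlinarith [mul_nonneg ht.le hp, sq_nonneg (t * v 0), sq_nonneg (t * v 1)]
    · have := hd.tendsto_slope_zero_left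
      refine tendsto_nhds_unique this (tendsto_const_nhds.congr' ?_)
      filter_upwards [self_mem_nhdsWithin] with t (ht : t < 0)
      rw [hf x hx, hf (x + t • v)]
      · simp
      · simp only [Pi.add_apply, Pi.smul_apply, smul_eq_mul]
        nlinarith [mul_nonneg_of_nonpos_of_nonpos ht.le hp, sq_nonneg (t * v 0), sq_nonneg (t * v 1)]
  · exact lineDeriv_zero_of_not_lineDifferentiableAt h

lemma enorm2_lt (x : E2) : enorm2 x < 1 ↔ x 0 ^ 2 + x 1 ^ 2 < 1 := by
  unfold enorm2; rw [Real.sqrt_lt' one_pos]; norm_num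

lemma enorm2_le (x : E2) : enorm2 x ≤ 1 ↔ x 0 ^ 2 + x 1 ^ 2 ≤ 1 := by
  unfold enorm2; rw [Real.sqrt_le_left zero_le_one]; norm_num

lemma enorm2_eq (x : E2) : enorm2 x = 1 ↔ x 0 ^ 2 + x 1 ^ 2 = 1 := by
  unfold enorm2; rw [Real.sqrt_eq_one]

/-- zero extension of a map vanishing on the sphere is Lipschitz -/
lemma lip_extend {ψ : E2 → E2} {K : ℝ≥0} (hψ : LipschitzOnWith K ψ {x | x 0 ^ 2 + x 1 ^ 2 ≤ 1})
    (h0 : ∀ x : E2, x 0 ^ 2 + x 1 ^ 2 = 1 → ψ x = 0) :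
    LipschitzWith K ({x : E2 | x 0 ^ 2 + x 1 ^ 2 ≤ 1}.indicator ψ) := by
  set S := {x : E2 | x 0 ^ 2 + x 1 ^ 2 ≤ 1}
  have aux : ∀ x ∈ S, ∀ y ∉ S, dist (S.indicator ψ x) (S.indicator ψ y) ≤ K * dist x y := by
    intro x hx y hy
    have hx' : x 0 ^ 2 + x 1 ^ 2 ≤ 1 := hx
    have hy' : 1 < x 0 ^ 2 + x 1 ^ 2 ∨ 1 < y 0 ^ 2 + y 1 ^ 2 := Or.inr (not_le.1 hy)
    have hy'' : 1 < y 0 ^ 2 + y 1 ^ 2 := not_le.1 hy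
    have hc : ContinuousOn (fun t : ℝ => (x 0 + t * (y 0 - x 0)) ^ 2 + (x 1 + t * (y 1 - x 1)) ^ 2)
      (Icc 0 1) := by fun_prop
    obtain ⟨t, ht, hz⟩ := intermediate_value_Icc zero_le_one hc
      (show (1:ℝ) ∈ Icc _ _ by constructor <;> simp <;> linarith)
    set z : E2 := x + t • (y - x) with hzdef
    have hz1 : z 0 ^ 2 + z 1 ^ 2 = 1 := by simpa [hzdef] using hz
    have hzS : z ∈ S := hz1.le
    rw [indicator_of_mem hx, indicator_of_notMem hy, ← h0 z hz1]
    refine (hψ.dist_le_mul x hx z hzS).trans ?_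
    gcongr
    rw [hzdef, dist_self_add_right, norm_smul, dist_comm, dist_eq_norm, Real.norm_of_nonneg ht.1]
    exact mul_le_of_le_one_left (norm_nonneg _) ht.2
  refine LipschitzWith.of_dist_le_mul fun x y => ?_
  by_cases hx : x ∈ S <;> by_cases hy : y ∈ S
  · rw [indicator_of_mem hx, indicator_of_mem hy]; exact hψ.dist_le_mul x hx y hy
  · exact aux x hx y hy
  · rw [dist_comm, dist_comm x]; exact aux y hy x hx
  · rw [indicator_of_notMem hx, indicator_of_notMem hy]; simp; positivity

lemma diag_null : ∀ᵐ x ∂(volume : Measure E2), |x 0| ≠ |x 1| := by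
  have h : ∀ c : ℝ, volume {x : E2 | x 0 = c * x 1} = 0 := by
    intro c
    let L : E2 →ₗ[ℝ] ℝ := LinearMap.proj 0 - c • LinearMap.proj 1
    have : {x : E2 | x 0 = c * x 1} = (LinearMap.ker L : Set E2) := by
      ext x; simp [L, sub_eq_zero]
    rw [this]
    apply Measure.addHaar_submodule
    intro h
    have : (![1, 0] : E2) ∈ LinearMap.ker L := by rw [h]; trivial
    simp [L] at this
  have h1 := h 1
  have h2 := h (-1)
  rw [← compl_compl {x : E2 | x 0 = _ * x 1}] at h1 h2
  filter_upwards [mem_ae_iff.2 h1, mem_ae_iff.2 h2] with x hx1 hx2 hx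
  rcases abs_eq_abs.1 hx with h | h
  · exact hx1 (by simpa using h)
  · exact hx2 (by simpa using h)

lemma eta_lip (k : Fin 2) : LipschitzWith 1 (fun x : E2 => max (x k - 3/4) 0) := by
  have h : LipschitzWith 1 (fun x : E2 => x k - 3/4) := by
    refine LipschitzWith.of_dist_le_mul fun x y => ?_
    simpa [Real.dist_eq] using dist_le_pi_dist x y k
  exact h.max_const 0

lemma cap_bound {f : Fin 2 → E2 → ℝ} {C : ℝ≥0} (hf : ∀ i, LipschitzWith C (f i))
    (hfc : ∀ i, HasCompactSupport (f i)) (hf0 : ∀ i x, 1 ≤ x 0 ^ 2 + x 1 ^ 2 → f i x = 0)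
    (j k : Fin 2) (hjk : k ≠ j) (a b : ℝ)
    (H : ∀ᵐ x ∂(volume : Measure E2), x 0 ^ 2 + x 1 ^ 2 < 1 → 3/4 < x k →
      (lineDeriv ℝ (f 0) x (Pi.single j 1) + a) ^ 2 +
      (lineDeriv ℝ (f 1) x (Pi.single j 1) + b) ^ 2 = 1) : a ^ 2 + b ^ 2 ≤ 1 := by
  by_contra hlt
  push Not at hlt
  set v : E2 := Pi.single j 1 with hv
  set η : E2 → ℝ := fun x => max (x k - 3/4) 0 with hη
  have hη0 : ∀ x, 0 ≤ η x := fun x => le_max_right _ _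
  have hI : ∀ i, ∫ x, lineDeriv ℝ (f i) x v * η x = 0 := by
    intro i
    have h := (eta_lip k).integral_lineDeriv_mul_eq (μ := volume) (hf i) (hfc i) (-v)
    simp only [neg_neg] at h
    rw [← h]
    have : ∀ x, lineDeriv ℝ (fun x : E2 => max (x k - 3/4) 0) x (-v) = 0 := by
      intro x
      simp [lineDeriv, hv, hjk]
    simp [this]
  have hint : ∀ i, Integrable (fun x => lineDeriv ℝ (f i) x v * η x) volume := by
    intro i
    have h1 := (lineDeriv_integrable (hf i) (hfc i) v)
    have h2 : (fun x => lineDeriv ℝ (f i) x v * η x)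
        = fun x => (min (η x) 1) * lineDeriv ℝ (f i) x v := by
      funext x
      by_cases hx : 1 ≤ x 0 ^ 2 + x 1 ^ 2
      · rw [lineDeriv_outside (hf0 i) x v hx]; simp
      · rw [min_eq_left, mul_comm]
        have : x k ≤ 1 := by
          fin_cases k <;> simp <;> nlinarith [sq_nonneg (x 0), sq_nonneg (x 1)]
        exact max_le (by linarith) zero_le_one
    rw [h2]
    refine h1.bdd_mul (c := 1) ?_ (Eventually.of_forall fun x => ?_)
    · exact ((eta_lip k).continuous.min continuous_const).aestronglyMeasurable
    · rw [Real.norm_of_nonneg (le_min (hη0 x) zero_le_one)]; exact min_le_right _ _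
  set P : E2 → ℝ := fun x => -(a * (lineDeriv ℝ (f 0) x v * η x) + b * (lineDeriv ℝ (f 1) x v * η x))
    with hP
  have hPi : ∫ x, P x = 0 := by
    rw [hP, integral_neg, integral_add ((hint 0).const_mul a) ((hint 1).const_mul b),
      integral_const_mul, integral_const_mul, hI, hI]
    simp
  have hPint : Integrable P volume := (((hint 0).const_mul a).add ((hint 1).const_mul b)).neg
  have key : ∀ᵐ x ∂(volume : Measure E2), 0 ≤ P x ∧
      (x 0 ^ 2 + x 1 ^ 2 < 1 → 3/4 < x k → 0 < P x) := by
    filter_upwards [H] with x hx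
    by_cases hB : x 0 ^ 2 + x 1 ^ 2 < 1
    · by_cases hk : 3/4 < x k
      · have h := hx hB hk
        have hp : 0 < η x := lt_max_of_lt_left (by linarith)
        have : 0 < P x := by
          have : P x = -(a * lineDeriv ℝ (f 0) x v + b * lineDeriv ℝ (f 1) x v) * η x := by
            simp only [hP]; ring
          rw [this]
          apply mul_pos _ hp
          nlinarith [sq_nonneg (lineDeriv ℝ (f 0) x v), sq_nonneg (lineDeriv ℝ (f 1) x v)]
        exact ⟨this.le, fun _ _ => this⟩
      · have : η x = 0 := max_eq_right (by linarith)
        exact ⟨by simp [hP, this], fun _ h => absurd h hk⟩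
    · have h0 := lineDeriv_outside (hf0 0) x v (not_lt.1 hB)
      have h1 := lineDeriv_outside (hf0 1) x v (not_lt.1 hB)
      exact ⟨by simp [hP, h0, h1], fun h => absurd h hB⟩
  have hz := (integral_eq_zero_iff_of_nonneg_ae (key.mono fun x h => h.1) hPint).1 hPi
  have hU : volume {x : E2 | x 0 ^ 2 + x 1 ^ 2 < 1 ∧ 3/4 < x k} = 0 := by
    rw [← compl_compl {x : E2 | _}]
    refine mem_ae_iff.1 ?_
    filter_upwards [hz, key] with x h1 h2 h3
    have := h2.2 h3.1 h3.2
    rw [h1] at this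
    exact lt_irrefl _ this
  refine (IsOpen.measure_ne_zero volume ?_ ?_) hU
  · have o1 : IsOpen {x : E2 | x 0 ^ 2 + x 1 ^ 2 < 1} := isOpen_lt (by fun_prop) (by fun_prop)
    have o2 : IsOpen {x : E2 | 3/4 < x k} := isOpen_lt (by fun_prop) (by fun_prop)
    exact o1.inter o2
  · refine ⟨Pi.single k (4/5), ?_⟩
    fin_cases k <;> simp <;> norm_num

lemma det_one {f : Fin 2 → E2 → ℝ} {C : ℝ≥0} (hf : ∀ i, LipschitzWith C (f i))
    (hfc : ∀ i, HasCompactSupport (f i)) (hf0 : ∀ i x, 1 ≤ x 0 ^ 2 + x 1 ^ 2 → f i x = 0)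
    (a b c d : ℝ)
    (H : ∀ᵐ x ∂(volume : Measure E2), x 0 ^ 2 + x 1 ^ 2 < 1 →
      (lineDeriv ℝ (f 0) x (Pi.single 0 1) + a) * (lineDeriv ℝ (f 1) x (Pi.single 1 1) + d) -
      (lineDeriv ℝ (f 0) x (Pi.single 1 1) + b) * (lineDeriv ℝ (f 1) x (Pi.single 0 1) + c) = 1) :
    a * d - b * c = 1 := by
  set L : Fin 2 → Fin 2 → E2 → ℝ := fun i j x => lineDeriv ℝ (f i) x (Pi.single j 1) with hL
  have hi : ∀ i j, Integrable (L i j) volume := fun i j => lineDeriv_integrable (hf i) (hfc i) _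
  have hz : ∀ i j, ∫ x, L i j x = 0 := fun i j => integral_lineDeriv_zero (hf i) (hfc i) _
  have hm : ∀ i j, Integrable (fun x => L 0 i x * L 1 j x) volume := fun i j =>
    lineDeriv_mul_integrable (hf 0) (hf 1) (hfc 1) _ _
  have hn : ∫ x, L 0 0 x * L 1 1 x = ∫ x, L 0 1 x * L 1 0 x :=
    null_lagrangian (hf 0) (hf 1) (hfc 0) (hfc 1) _ _
  have hG : ∫ x, (((L 0 0 x * d + L 1 1 x * a) - (L 0 1 x * c + L 1 0 x * b)) +
      (L 0 0 x * L 1 1 x - L 0 1 x * L 1 0 x)) = 0 := by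
    have i1 := (hi 0 0).mul_const d
    have i2 := (hi 1 1).mul_const a
    have i3 := (hi 0 1).mul_const c
    have i4 := (hi 1 0).mul_const b
    have j1 : Integrable (fun x => L 0 0 x * d + L 1 1 x * a) volume := i1.add i2
    have j2 : Integrable (fun x => L 0 1 x * c + L 1 0 x * b) volume := i3.add i4
    have j3 : Integrable (fun x => (L 0 0 x * d + L 1 1 x * a) - (L 0 1 x * c + L 1 0 x * b))
      volume := j1.sub j2
    have j4 : Integrable (fun x => L 0 0 x * L 1 1 x - L 0 1 x * L 1 0 x) volume :=
      (hm 0 1).sub (hm 1 0)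
    rw [integral_add j3 j4, integral_sub j1 j2, integral_add i1 i2, integral_add i3 i4,
      integral_sub (hm 0 1) (hm 1 0), hn]
    simp [integral_mul_const, hz]
  set B := {x : E2 | x 0 ^ 2 + x 1 ^ 2 < 1} with hB
  have hBo : IsOpen B := isOpen_lt (by fun_prop) (by fun_prop)
  have hae : (fun x => (((L 0 0 x * d + L 1 1 x * a) - (L 0 1 x * c + L 1 0 x * b)) +
      (L 0 0 x * L 1 1 x - L 0 1 x * L 1 0 x))) =ᵐ[volume]
      B.indicator (fun _ => 1 - (a * d - b * c)) := by
    filter_upwards [H] with x hx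
    by_cases hxB : x ∈ B
    · rw [indicator_of_mem hxB]
      have := hx hxB
      simp only [hL]
      linarith
    · rw [indicator_of_notMem hxB]
      have : ∀ i j, L i j x = 0 := fun i j => lineDeriv_outside (hf0 i) x _ (not_lt.1 hxB)
      simp [this]
  rw [integral_congr_ae hae, integral_indicator hBo.measurableSet, setIntegral_const] at hG
  have hB1 : volume B ≠ 0 := hBo.measure_ne_zero volume ⟨0, by simp [hB]⟩
  have hB2 : volume B ≠ ⊤ := by
    have : B ⊆ Metric.closedBall 0 1 := by
      intro x hx
      have hx : x 0 ^ 2 + x 1 ^ 2 < 1 := hx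
      rw [mem_closedBall_zero_iff, pi_norm_le_iff_of_nonneg zero_le_one]
      intro i
      rw [Real.norm_eq_abs, abs_le_one_iff_mul_self_le_one]
      fin_cases i <;> simp <;> nlinarith [sq_nonneg (x 0), sq_nonneg (x 1)]
    exact ((measure_mono this).trans_lt measure_closedBall_lt_top).ne
  have : volume.real B ≠ 0 := by
    simp [Measure.real, ENNReal.toReal_eq_zero_iff, hB1, hB2]
  have := (mul_eq_zero.1 (by simpa using hG)).resolve_left this
  linarith

lemma so2_of {F : M2} (h1 : F 0 0 ^ 2 + F 1 0 ^ 2 ≤ 1) (h2 : F 0 1 ^ 2 + F 1 1 ^ 2 ≤ 1)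
    (h3 : F 0 0 * F 1 1 - F 0 1 * F 1 0 = 1) : F ∈ SO2 := by
  have h4 : (F 0 0 - F 1 1) ^ 2 + (F 0 1 + F 1 0) ^ 2 ≤ 0 := by nlinarith
  have h5 : F 0 0 = F 1 1 := by
    nlinarith [sq_nonneg (F 0 0 - F 1 1), sq_nonneg (F 0 1 + F 1 0)]
  have h6 : F 0 1 = - F 1 0 := by
    nlinarith [sq_nonneg (F 0 0 - F 1 1), sq_nonneg (F 0 1 + F 1 0)]
  have h7 : F 0 0 ^ 2 + F 1 0 ^ 2 = 1 := by rw [← h3, ← h5, h6]; ring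
  set z : ℂ := ⟨F 0 0, F 1 0⟩ with hz
  have hn : ‖z‖ = 1 := by
    rw [Complex.norm_def, Complex.normSq_mk, Real.sqrt_eq_one]; linarith
  have hz0 : z ≠ 0 := by rw [← norm_ne_zero_iff, hn]; exact one_ne_zero
  refine ⟨Complex.arg z, ?_⟩
  have hc : Real.cos (Complex.arg z) = F 0 0 := by rw [Complex.cos_arg hz0, hn]; simp [hz]
  have hs : Real.sin (Complex.arg z) = F 1 0 := by rw [Complex.sin_arg, hn]; simp [hz]
  unfold rot
  rw [hc, hs]
  ext i j
  fin_cases i <;> fin_cases j <;> simp [h5, h6]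

lemma grad_apply (u : E2 → E2) (x : E2) (i j : Fin 2) :
    gradMatrix u x i j = fderiv ℝ u x (Pi.single j 1) i := by
  simp [gradMatrix, LinearMap.toMatrix'_apply]

lemma backward {F : M2} {u : E2 → E2} {K : ℝ≥0}
    (hu : LipschitzOnWith K u {x : E2 | enorm2 x ≤ 1})
    (hb : ∀ x : E2, enorm2 x = 1 → u x = F.mulVec x)
    (hd : ∀ᵐ x ∂(volume : Measure E2), enorm2 x < 1 → DifferentiableAt ℝ u x)
    (h1 : ∀ᵐ x ∂(volume : Measure E2),
          (enorm2 x < 1 ∧ (|x 0| < x 1 ∨ x 1 < -|x 0|)) → gradMatrix u x ∈ calM e1)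
    (h2 : ∀ᵐ x ∂(volume : Measure E2),
          (enorm2 x < 1 ∧ (x 0 < -|x 1| ∨ |x 1| < x 0)) → gradMatrix u x ∈ calM e2) :
    F ∈ SO2 := by
  simp only [enorm2_lt, enorm2_le, enorm2_eq] at hu hb hd h1 h2
  let A : E2 →L[ℝ] E2 := LinearMap.toContinuousLinearMap (Matrix.toLin' F)
  have hA : ∀ x, A x = F.mulVec x := fun x => by simp [A]
  set ψ : E2 → E2 := fun x => u x - A x with hψ
  have hψL : LipschitzOnWith (K + ‖A‖₊) ψ {x | x 0 ^ 2 + x 1 ^ 2 ≤ 1} :=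
    hu.sub A.lipschitz.lipschitzOnWith
  have hψ0 : ∀ x : E2, x 0 ^ 2 + x 1 ^ 2 = 1 → ψ x = 0 := by
    intro x hx; simp only [hψ, hb x hx, hA, sub_self]
  set φ := ({x : E2 | x 0 ^ 2 + x 1 ^ 2 ≤ 1}.indicator ψ) with hφ
  have hφL : LipschitzWith (K + ‖A‖₊) φ := lip_extend hψL hψ0
  have hφ0 : ∀ x : E2, 1 ≤ x 0 ^ 2 + x 1 ^ 2 → φ x = 0 := by
    intro x hx
    rcases hx.eq_or_lt with h | h
    · rw [hφ, indicator_of_mem (show x ∈ {x : E2 | x 0 ^ 2 + x 1 ^ 2 ≤ 1} from h.ge)]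
      exact hψ0 x h.symm
    · have hn : x ∉ {x : E2 | x 0 ^ 2 + x 1 ^ 2 ≤ 1} := not_le.2 h
      exact indicator_of_notMem hn _
  set f : Fin 2 → E2 → ℝ := fun i x => φ x i with hfdef
  have hf : ∀ i, LipschitzWith (K + ‖A‖₊) (f i) := by
    intro i
    refine LipschitzWith.of_dist_le_mul fun x y => ?_
    exact (dist_le_pi_dist (φ x) (φ y) i).trans (hφL.dist_le_mul x y)
  have hf0 : ∀ i x, 1 ≤ x 0 ^ 2 + x 1 ^ 2 → f i x = 0 := by
    intro i x hx; simp [hfdef, hφ0 x hx]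
  have hfc : ∀ i, HasCompactSupport (f i) := by
    intro i
    refine HasCompactSupport.intro (isCompact_closedBall (0 : E2) 1) fun x hx => hf0 i x ?_
    by_contra hlt
    push Not at hlt
    apply hx
    rw [mem_closedBall_zero_iff, pi_norm_le_iff_of_nonneg zero_le_one]
    intro i
    rw [Real.norm_eq_abs, abs_le_one_iff_mul_self_le_one]
    fin_cases i <;> simp <;> nlinarith [sq_nonneg (x 0), sq_nonneg (x 1)]
  have hld : ∀ᵐ x ∂(volume : Measure E2), x 0 ^ 2 + x 1 ^ 2 < 1 → ∀ i j,
      lineDeriv ℝ (f i) x (Pi.single j 1) + F i j = gradMatrix u x i j := by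
    filter_upwards [hd] with x hx hxB i j
    have hdx := (hx hxB).hasFDerivAt
    have h3 : HasFDerivAt ψ (fderiv ℝ u x - A) x := hdx.sub A.hasFDerivAt
    have h4 : HasFDerivAt φ (fderiv ℝ u x - A) x := by
      refine h3.congr_of_eventuallyEq ?_
      have : {x : E2 | x 0 ^ 2 + x 1 ^ 2 < 1} ∈ 𝓝 x :=
        (isOpen_lt (by fun_prop) (by fun_prop)).mem_nhds hxB
      filter_upwards [this] with y hy
      exact indicator_of_mem (show y ∈ {x : E2 | x 0 ^ 2 + x 1 ^ 2 ≤ 1} from le_of_lt hy) _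
    have h5 := (hasFDerivAt_pi'.1 h4 i).hasLineDerivAt (Pi.single j 1)
    rw [h5.lineDeriv, grad_apply]
    simp [hA]
  have hcal1 : ∀ G : M2, G ∈ calM e1 →
      G 0 0 * G 1 1 - G 0 1 * G 1 0 = 1 ∧ G 0 0 ^ 2 + G 1 0 ^ 2 = 1 := by
    rintro G ⟨ha, hb⟩
    rw [Matrix.det_fin_two] at ha
    rw [enorm2_eq] at hb
    exact ⟨ha, by simpa [e1, Matrix.mulVec, dotProduct, Fin.sum_univ_two] using hb⟩
  have hcal2 : ∀ G : M2, G ∈ calM e2 →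
      G 0 0 * G 1 1 - G 0 1 * G 1 0 = 1 ∧ G 0 1 ^ 2 + G 1 1 ^ 2 = 1 := by
    rintro G ⟨ha, hb⟩
    rw [Matrix.det_fin_two] at ha
    rw [enorm2_eq] at hb
    exact ⟨ha, by simpa [e2, Matrix.mulVec, dotProduct, Fin.sum_univ_two] using hb⟩
  apply so2_of
  · refine cap_bound hf hfc hf0 0 1 (by decide) _ _ ?_
    filter_upwards [hld, h1] with x hx hx1 hB hk
    rw [hx hB, hx hB]
    refine (hcal1 _ (hx1 ⟨hB, Or.inl ?_⟩)).2
    exact abs_lt_of_sq_lt_sq (by nlinarith) (by linarith)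
  · refine cap_bound hf hfc hf0 1 0 (by decide) _ _ ?_
    filter_upwards [hld, h2] with x hx hx1 hB hk
    rw [hx hB, hx hB]
    refine (hcal2 _ (hx1 ⟨hB, Or.inr ?_⟩)).2
    exact abs_lt_of_sq_lt_sq (by nlinarith) (by linarith)
  · refine det_one hf hfc hf0 _ _ _ _ ?_
    filter_upwards [hld, h1, h2, diag_null] with x hx hx1 hx2 hne hB
    rw [hx hB, hx hB, hx hB, hx hB]
    rcases lt_or_gt_of_ne hne with h | h
    · refine (hcal1 _ (hx1 ⟨hB, ?_⟩)).1
      rcases lt_abs.1 h with h | h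
      · exact Or.inl h
      · exact Or.inr (by linarith)
    · refine (hcal2 _ (hx2 ⟨hB, ?_⟩)).1
      rcases lt_abs.1 h with h | h
      · exact Or.inr h
      · exact Or.inl (by linarith)

lemma forward {F : M2} (hF : F ∈ SO2) :
      ∃ (u : (Fin 2 → ℝ) → Fin 2 → ℝ) (K : NNReal),
        LipschitzOnWith K u {x : Fin 2 → ℝ | enorm2 x ≤ 1} ∧
        (∀ x : Fin 2 → ℝ, enorm2 x = 1 → u x = F.mulVec x) ∧
        (∀ x, DifferentiableAt ℝ u x) ∧ (∀ x, gradMatrix u x ∈ calM e1 ∧ gradMatrix u x ∈ calM e2) := by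
  obtain ⟨θ, rfl⟩ := hF
  let A : E2 →L[ℝ] E2 := LinearMap.toContinuousLinearMap (Matrix.toLin' (rot θ))
  have hA : ∀ x, A x = (rot θ).mulVec x := fun x => by simp [A]
  refine ⟨A, ‖A‖₊, A.lipschitz.lipschitzOnWith, fun x _ => hA x,
    fun x => A.differentiableAt, fun x => ?_⟩
  have hg : gradMatrix A x = rot θ := by
    ext i j
    rw [grad_apply, ContinuousLinearMap.fderiv, hA]
    simp
  have hs := Real.sin_sq_add_cos_sq θ
  rw [hg]
  refine ⟨⟨?_, ?_⟩, ⟨?_, ?_⟩⟩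
  · simp [Matrix.det_fin_two, rot]; linarith
  · rw [enorm2_eq]; simp [rot, e1]
  · simp [Matrix.det_fin_two, rot]; linarith
  · rw [enorm2_eq]; simp [rot, e2]

/-- Rigidity of the four-sector polycrystal on the unit ball: the differential
inclusion with 𝓜_{e1} on Ω₁ ∪ Ω₃ and 𝓜_{e2} on Ω₂ ∪ Ω₄ and affine boundary values F x
is solvable iff F ∈ SO(2). -/
theorem stmt17 (F : M2) :
    F ∈ SO2 ↔
      ∃ (u : (Fin 2 → ℝ) → Fin 2 → ℝ) (K : NNReal),
        LipschitzOnWith K u {x : Fin 2 → ℝ | enorm2 x ≤ 1} ∧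
        (∀ x : Fin 2 → ℝ, enorm2 x = 1 → u x = F.mulVec x) ∧
        (∀ᵐ x ∂(volume : Measure (Fin 2 → ℝ)), enorm2 x < 1 → DifferentiableAt ℝ u x) ∧
        (∀ᵐ x ∂(volume : Measure (Fin 2 → ℝ)),
          (enorm2 x < 1 ∧ (|x 0| < x 1 ∨ x 1 < -|x 0|)) → gradMatrix u x ∈ calM e1) ∧
        (∀ᵐ x ∂(volume : Measure (Fin 2 → ℝ)),
          (enorm2 x < 1 ∧ (x 0 < -|x 1| ∨ |x 1| < x 0)) → gradMatrix u x ∈ calM e2) := by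


  constructor
  · intro hF
    obtain ⟨u, K, h1, h2, h3, h4⟩ := forward hF
    exact ⟨u, K, h1, h2, Eventually.of_forall fun x _ => h3 x,
      Eventually.of_forall fun x _ => (h4 x).1, Eventually.of_forall fun x _ => (h4 x).2⟩
  · rintro ⟨u, K, hu, hb, hd, h1, h2⟩
    exact backward hu hb hd h1 h2
end
end

section
/- Let Ω ⊂ ℝ² be a bounded open set, F ∈ ℝ^{2×2}, and let V₁,…,V_m be finitely many pairwise disjoint open subsets of Ω whose union has full Lebesgue measure in Ω. Let Q₁,…,Q_m ∈ SO(2), and let v be a continuous map from the closure of Ω to ℝ² such that v(x) = F x for every x in the topological boundary of Ω and, for each i, v restricted to V_i is affine, i.e. v(x) = A_i x + b_i on V_i, with A_i Q_i ∈ 𝓝. Then there exists a Lipschitz map u from the closure of Ω to ℝ² such that u(x) = F x for every x in the topological boundary of Ω and, for each i, u is differentiable at almost every x ∈ V_i with its derivative D u(x) (as a 2×2 matrix) satisfying D u(x) Q_i ∈ 𝓜. -/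
open Matrix Real Set MeasureTheory

noncomputable section

lemma exists_frontier_on_segment {V : Set E2} (hV : IsOpen V) {x y : E2} (hx : x ∈ V) (hy : y ∉ V) :
    ∃ z ∈ segment ℝ x y, z ∈ frontier V := by
  by_contra hcon
  push Not at hcon
  have hpre : IsPreconnected (segment ℝ x y) := (convex_segment x y).isPreconnected
  have hsub : segment ℝ x y ⊆ V ∪ (closure V)ᶜ := by
    intro z hz
    by_cases hzV : z ∈ V
    · exact Or.inl hzV
    · right
      intro hzc
      apply hcon z hz
      rw [hV.frontier_eq]
      exact ⟨hzc, hzV⟩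
  have h1 := hpre.subset_left_of_subset_union hV isClosed_closure.isOpen_compl
    (Set.disjoint_left.2 fun z hz hz' => hz' (subset_closure hz)) hsub
    ⟨x, left_mem_segment ℝ x y, hx⟩
  exact hy (h1 (right_mem_segment ℝ x y))

lemma dist_add_of_segment {x y z : E2} (hz : z ∈ segment ℝ x y) :
    dist x z + dist z y = dist x y :=
  dist_add_dist_of_mem_segment hz

/-- Gluing Lipschitz maps along disjoint open sets. -/
lemma glue_lipschitz {ι : Type*} (V : ι → Set E2) (hV : ∀ i, IsOpen (V i))
    (hd : ∀ i j, i ≠ j → Disjoint (V i) (V j)) (L : NNReal) (g : E2 → E2)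
    (hg : LipschitzWith L g) (f : ι → E2 → E2) (hf : ∀ i, LipschitzWith L (f i))
    (hfg : ∀ i, ∀ x ∈ frontier (V i), f i x = g x) (u : E2 → E2)
    (hu1 : ∀ i, ∀ x ∈ V i, u x = f i x) (hu2 : ∀ x, (∀ i, x ∉ V i) → u x = g x) :
    LipschitzWith L u := by
  have hfr : ∀ i j, ∀ x ∈ frontier (V i), x ∉ V j := by
    intro i j x hx hxj
    by_cases hij : i = j
    · subst hij
      rw [(hV i).frontier_eq] at hx
      exact hx.2 hxj
    · obtain ⟨z, hz1, hz2⟩ := mem_closure_iff.1 (frontier_subset_closure hx) _ (hV j) hxj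
      exact Set.disjoint_left.1 (hd i j hij) hz2 hz1
  -- point outside all sets versus arbitrary point
  have key : ∀ x y, (∀ i, x ∉ V i) → dist (u x) (u y) ≤ L * dist x y := by
    intro x y hx
    by_cases hy : ∀ i, y ∉ V i
    · rw [hu2 x hx, hu2 y hy]
      exact hg.dist_le_mul x y
    · push Not at hy
      obtain ⟨j, hj⟩ := hy
      obtain ⟨z, hz, hzf⟩ := exists_frontier_on_segment (hV j) hj (hx j)
      have h1 := dist_add_of_segment hz
      rw [hu2 x hx, hu1 j y hj]
      calc dist (g x) (f j y) ≤ dist (g x) (g z) + dist (g z) (f j y) := dist_triangle _ _ _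
        _ = dist (g x) (g z) + dist (f j z) (f j y) := by rw [hfg j z hzf]
        _ ≤ L * dist x z + L * dist z y := add_le_add (hg.dist_le_mul x z) ((hf j).dist_le_mul z y)
        _ = L * (dist y z + dist z x) := by rw [dist_comm x z, dist_comm z y]; ring
        _ = L * dist x y := by rw [h1, dist_comm]
  refine LipschitzWith.of_dist_le_mul fun x y => ?_
  by_cases hx : ∀ i, x ∉ V i
  · exact key x y hx
  · push Not at hx
    obtain ⟨i, hi⟩ := hx
    by_cases hy : y ∈ V i
    · rw [hu1 i x hi, hu1 i y hy]
      exact (hf i).dist_le_mul x y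
    · obtain ⟨z, hz, hzf⟩ := exists_frontier_on_segment (hV i) hi hy
      have h1 := dist_add_of_segment hz
      have hzo : ∀ j, z ∉ V j := fun j => hfr i j z hzf
      have h2 := key z y hzo
      calc dist (u x) (u y) ≤ dist (u x) (u z) + dist (u z) (u y) := dist_triangle _ _ _
        _ = dist (f i x) (f i z) + dist (u z) (u y) := by
            rw [hu1 i x hi, hu2 z hzo, hfg i z hzf]
        _ ≤ L * dist x z + L * dist z y := add_le_add ((hf i).dist_le_mul x z) h2
        _ = L * dist x y := by rw [← h1]; ring

/-- A continuous selection of finitely many Lipschitz maps is Lipschitz. -/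
lemma selection_lipschitz {ι : Type*} [Finite ι] (L : NNReal) (g : ι → E2 → E2)
    (hg : ∀ i, LipschitzWith L (g i)) (f : E2 → E2) (hf : Continuous f)
    (hsel : ∀ x, ∃ i, f x = g i x) : LipschitzWith L f := by
  refine LipschitzWith.of_dist_le_mul fun x y => ?_
  let γ : ℝ → E2 := fun t => x + t • (y - x)
  have hγ : Continuous γ := by fun_prop
  have hγd : ∀ s t, s ≤ t → dist (γ s) (γ t) = (t - s) * dist x y := by
    intro s t hst
    simp only [γ, dist_eq_norm]
    have : x + s • (y - x) - (x + t • (y - x)) = (t - s) • (x - y) := by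
      ext i; simp; ring
    rw [this, norm_smul, Real.norm_of_nonneg (by linarith)]
  let S : Set ℝ := {t | dist (f x) (f (γ t)) ≤ L * (t * dist x y)}
  have hScl : IsClosed S := by
    apply isClosed_le <;> fun_prop
  have h01 : Icc (0:ℝ) 1 ⊆ S := by
    apply IsClosed.Icc_subset_of_forall_exists_gt (hScl.inter isClosed_Icc)
    · simp [S, γ]
    · rintro t ⟨htS, ht0, ht1⟩ b hb
      -- pigeonhole
      have hfreq : ∃ i, ∃ᶠ s in nhdsWithin t (Ioi t), f (γ s) = g i (γ s) := by
        by_contra hcon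
        push Not at hcon
        have := (Filter.eventually_all.2 fun i => hcon i).exists
        obtain ⟨s, hs⟩ := this
        obtain ⟨i, hi⟩ := hsel (γ s)
        exact hs i hi
      obtain ⟨i, hi⟩ := hfreq
      have hti : f (γ t) = g i (γ t) := by
        have hcl : IsClosed {s | f (γ s) = g i (γ s)} :=
          isClosed_eq (hf.comp hγ) ((hg i).continuous.comp hγ)
        exact hcl.mem_of_frequently_of_tendsto hi
          (Filter.tendsto_id.mono_left nhdsWithin_le_nhds)
      obtain ⟨s, hs1, hs2⟩ := (hi.and_eventually (Ioc_mem_nhdsGT hb)).exists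
      refine ⟨s, ?_, hs2⟩
      have e1 := (hg i).dist_le_mul (γ t) (γ s)
      rw [hγd t s hs2.1.le, ← hti, ← hs1] at e1
      have e2 : dist (f x) (f (γ t)) ≤ L * (t * dist x y) := htS
      show dist (f x) (f (γ s)) ≤ L * (s * dist x y)
      calc _ ≤ _ := dist_triangle _ (f (γ t)) _
        _ ≤ L * (t * dist x y) + L * ((s - t) * dist x y) := add_le_add e2 e1
        _ = _ := by ring
  have h1 : (1:ℝ) ∈ S := h01 (by simp)
  have h2 : γ 1 = y := by simp [γ]
  simpa [S, h2] using h1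


/-- positive part of the first hat function -/
def posq (h x y : ℝ) : ℝ :=
  max 0 (min (min (3 * y / 2) (3 * (1 - y)))
    (min (3 * (2 + y - 3 * x) / (8 - 9 * h)) (3 * (2 + y + 3 * x) / (8 + 9 * h))))

/-- positive part of the second hat function -/
def posp (h x y : ℝ) : ℝ :=
  max 0 (min (min (3 * (1 - x)) ((6 * x - 9 * h * y) / 4))
    (min (3 * (3 * (1 - h) * (1 - y) - (1 - x)) / (8 - 9 * h))
      (3 * (3 * (1 + h) * (1 + y) - (1 - x)) / (8 + 9 * h))))

def phiq (h x y : ℝ) : ℝ := posq h x y - posq h (-x) (-y)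
def phip (h x y : ℝ) : ℝ := posp h x y - posp h (-x) (-y)

lemma max4_zero {a b c d : ℝ} (h : a ≤ 0 ∨ b ≤ 0 ∨ c ≤ 0 ∨ d ≤ 0) :
    max 0 (min (min a b) (min c d)) = 0 := by
  apply max_eq_left
  simp only [min_le_iff]
  tauto

lemma max4_eq {e a b c d : ℝ} (h0 : 0 ≤ e) (ha : e ≤ a) (hb : e ≤ b) (hc : e ≤ c) (hd : e ≤ d)
    (h : a = e ∨ b = e ∨ c = e ∨ d = e) :
    max 0 (min (min a b) (min c d)) = e := by
  have : min (min a b) (min c d) = e := by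
    apply le_antisymm
    · simp only [min_le_iff]
      rcases h with h | h | h | h <;> simp [h]
    · simp [*]
  rw [this, max_eq_right h0]

lemma max4_lip {a b c d a' b' c' d' r : ℝ} (ha : |a - a'| ≤ r) (hb : |b - b'| ≤ r)
    (hc : |c - c'| ≤ r) (hd : |d - d'| ≤ r) :
    |max 0 (min (min a b) (min c d)) - max 0 (min (min a' b') (min c' d'))| ≤ r := by
  refine (abs_max_sub_max_le_max _ _ _ _).trans (max_le ?_ ?_)
  · simpa using (abs_nonneg _).trans ha
  · refine (abs_min_sub_min_le_max _ _ _ _).trans (max_le ?_ ?_)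
    · exact (abs_min_sub_min_le_max _ _ _ _).trans (max_le ha hb)
    · exact (abs_min_sub_min_le_max _ _ _ _).trans (max_le hc hd)

section hats
variable {h x y : ℝ}

lemma posq_of_y (hy : y ≤ 0) : posq h x y = 0 :=
  max4_zero (Or.inl (by linarith))

lemma posq_zero (h1 : -1/10 ≤ h) (h2 : h ≤ 1/10)
    (hc : 1 ≤ y ∨ 2 + y - 3 * x ≤ 0 ∨ 2 + y + 3 * x ≤ 0) : posq h x y = 0 := by
  rcases hc with hc | hc | hc
  · exact max4_zero (Or.inr (Or.inl (by linarith)))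
  · exact max4_zero (Or.inr (Or.inr (Or.inl
      (div_nonpos_of_nonpos_of_nonneg (by linarith) (by linarith)))))
  · exact max4_zero (Or.inr (Or.inr (Or.inr
      (div_nonpos_of_nonpos_of_nonneg (by linarith) (by linarith)))))

lemma posp_zero (h1 : -1/10 ≤ h) (h2 : h ≤ 1/10)
    (hc : 1 ≤ x ∨ 6 * x - 9 * h * y ≤ 0 ∨ 3 * (1 - h) * (1 - y) - (1 - x) ≤ 0 ∨
      3 * (1 + h) * (1 + y) - (1 - x) ≤ 0) : posp h x y = 0 := by
  rcases hc with hc | hc | hc | hc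
  · exact max4_zero (Or.inl (by linarith))
  · exact max4_zero (Or.inr (Or.inl (by linarith)))
  · exact max4_zero (Or.inr (Or.inr (Or.inl
      (div_nonpos_of_nonpos_of_nonneg (by linarith) (by linarith)))))
  · exact max4_zero (Or.inr (Or.inr (Or.inr
      (div_nonpos_of_nonpos_of_nonneg (by linarith) (by linarith)))))

lemma posq_out (h1 : -1/10 ≤ h) (h2 : h ≤ 1/10) (hc : 1 ≤ |x| ∨ 1 ≤ |y|) : posq h x y = 0 := by
  rcases le_or_gt y 0 with hy | hy
  · exact posq_of_y hy
  · apply posq_zero h1 h2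
    rcases le_or_gt 1 y with hy1 | hy1
    · exact Or.inl hy1
    · rcases hc with hc | hc
      · rcases le_abs.1 hc with hc | hc
        · right; left; linarith
        · right; right; linarith
      · rw [abs_of_pos hy] at hc; linarith

lemma posp_out (h1 : -1/10 ≤ h) (h2 : h ≤ 1/10) (hc : 1 ≤ |x| ∨ 1 ≤ |y|) : posp h x y = 0 := by
  apply posp_zero h1 h2
  rcases le_or_gt 1 x with hx | hx
  · exact Or.inl hx
  right
  rcases le_or_gt 1 y with hy | hy
  · right; left; nlinarith
  rcases le_or_gt y (-1) with hy' | hy'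
  · right; right; nlinarith
  left
  rcases hc with hc | hc
  · rcases le_abs.1 hc with hc | hc
    · linarith
    · nlinarith
  · rcases le_abs.1 hc with hc | hc <;> linarith

lemma phiq_out (h1 : -1/10 ≤ h) (h2 : h ≤ 1/10) (hc : 1 ≤ |x| ∨ 1 ≤ |y|) : phiq h x y = 0 := by
  rw [phiq, posq_out h1 h2 hc, posq_out h1 h2 (by simpa using hc), sub_zero]

lemma phip_out (h1 : -1/10 ≤ h) (h2 : h ≤ 1/10) (hc : 1 ≤ |x| ∨ 1 ≤ |y|) : phip h x y = 0 := by
  rw [phip, posp_out h1 h2 hc, posp_out h1 h2 (by simpa using hc), sub_zero]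

lemma phiq_neg : phiq h (-x) (-y) = - phiq h x y := by simp [phiq]
lemma phip_neg : phip h (-x) (-y) = - phip h x y := by simp [phip]

/-- region T1 -/
lemma reg1 (h1 : -1/10 ≤ h) (h2 : h ≤ 1/10) (hx : x < 1) (ha : y < 3 * x - 2)
    (hb : -y < 3 * x - 2) : phiq h x y = 0 ∧ phip h x y = 3 * (1 - x) := by
  constructor
  · rw [phiq, posq_zero h1 h2 (by right; left; linarith),
      posq_zero h1 h2 (by right; right; linarith), sub_zero]
  · have hy : |y| < 3 * x - 2 := abs_lt.2 ⟨by linarith, ha⟩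
    have hhy : |h * y| ≤ 1/10 * |y| := by
      rw [abs_mul]; exact mul_le_mul_of_nonneg_right (abs_le.2 ⟨by linarith, h2⟩) (abs_nonneg _)
    have h3 := abs_le.1 hhy
    have h4 := abs_nonneg y
    rw [phip, posp_zero (x := -x) h1 h2 (by right; left; nlinarith), sub_zero]
    apply max4_eq
    · linarith
    · exact le_rfl
    · linarith
    · rw [le_div_iff₀ (by linarith)]
      nlinarith
    · rw [le_div_iff₀ (by linarith)]
      nlinarith
    · left; rfl

/-- inner region P, upper half -/
lemma regP (h1 : -1/10 ≤ h) (h2 : h ≤ 1/10) (hy : 0 < y)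
    (ha : 6 * x - 9 * h * y + 6 * y < 4) (hb : -(6 * x - 9 * h * y) + 6 * y < 4) :
    phiq h x y = 3 * y / 2 ∧ phip h x y = (6 * x - 9 * h * y) / 4 := by
  constructor
  · rw [phiq, posq_of_y (y := -y) (by linarith), sub_zero]
    apply max4_eq
    · linarith
    · exact le_rfl
    · linarith
    · rw [le_div_iff₀ (by linarith)]
      nlinarith
    · rw [le_div_iff₀ (by linarith)]
      nlinarith
    · left; rfl
  · rcases le_or_gt 0 (6 * x - 9 * h * y) with hT | hT
    · rw [phip, posp_zero (x := -x) h1 h2 (by right; left; nlinarith), sub_zero]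
      apply max4_eq
      · linarith
      · nlinarith
      · exact le_rfl
      · rw [le_div_iff₀ (by linarith)]
        have : 0 ≤ (4 - 6 * y - (6 * x - 9 * h * y)) * (6 - 9 * h) :=
          mul_nonneg (by linarith) (by linarith)
        linarith
      · rw [le_div_iff₀ (by linarith)]
        have : 0 ≤ (4 + 6 * y - (6 * x - 9 * h * y)) * (6 + 9 * h) :=
          mul_nonneg (by linarith) (by linarith)
        linarith
      · right; left; rfl
    · rw [phip, posp_zero (x := x) h1 h2 (by right; left; linarith), zero_sub, neg_eq_iff_eq_neg]
      apply max4_eq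
      · linarith
      · nlinarith
      · linarith
      · rw [le_div_iff₀ (by linarith)]
        have : 0 ≤ (4 + 6 * y + (6 * x - 9 * h * y)) * (6 - 9 * h) :=
          mul_nonneg (by linarith) (by linarith)
        linarith
      · rw [le_div_iff₀ (by linarith)]
        have : 0 ≤ (4 - 6 * y + (6 * x - 9 * h * y)) * (6 + 9 * h) :=
          mul_nonneg (by linarith) (by linarith)
        linarith
      · right; left; ring

/-- region T3 -/
lemma reg3 (h1 : -1/10 ≤ h) (h2 : h ≤ 1/10) (hy : y < 1) (hy' : 2 / 3 < y)
    (ha : 3 * (1 - h) * (1 - y) < 1 - x) (hb : 3 * (1 + h) * (1 - y) < 1 + x) :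
    phiq h x y = 3 * (1 - y) ∧ phip h x y = 0 := by
  constructor
  · rw [phiq, posq_of_y (y := -y) (by linarith), sub_zero]
    apply max4_eq
    · linarith
    · linarith
    · exact le_rfl
    · rw [le_div_iff₀ (by linarith)]
      linarith
    · rw [le_div_iff₀ (by linarith)]
      linarith
    · right; left; rfl
  · rw [phip, posp_zero h1 h2 (by right; right; left; linarith),
      posp_zero h1 h2 (by right; right; right; linarith), sub_zero]

/-- region T2 -/
lemma reg2 (h1 : -1/10 ≤ h) (h2 : h ≤ 1/10) (hy : 0 < y)
    (ha : 3 * x < 2 + y) (hb : 4 < 6 * x - 9 * h * y + 6 * y)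
    (hc : 1 - x < 3 * (1 - h) * (1 - y)) (hd : 3 * h * (2 + y) < 8 * x) :
    phiq h x y = 3 * (2 + y - 3 * x) / (8 - 9 * h) ∧
    phip h x y = 3 * (3 * (1 - h) * (1 - y) - (1 - x)) / (8 - 9 * h) := by
  have h8 : 0 < 8 - 9 * h := by linarith
  have h8' : 0 < 8 + 9 * h := by linarith
  constructor
  · rw [phiq, posq_of_y (y := -y) (by linarith), sub_zero]
    apply max4_eq
    · exact div_nonneg (by linarith) h8.le
    · rw [div_le_iff₀ h8]
      nlinarith
    · rw [div_le_iff₀ h8]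
      nlinarith
    · exact le_rfl
    · rw [div_le_div_iff₀ h8 h8']
      nlinarith
    · right; right; left; rfl
  · have hT : 0 ≤ 6 * x - 9 * h * y := by
      have e : (8 - 9 * h) * (6 * x - 9 * h * y) = 3 * (2 - 3 * h) * (6 * x - 9 * h * y + 6 * y - 4)
          + 12 * (3 * (1 - h) * (1 - y) - (1 - x)) := by ring
      have e1 : 0 ≤ 3 * (2 - 3 * h) * (6 * x - 9 * h * y + 6 * y - 4) :=
        mul_nonneg (by linarith) (by linarith)
      have e2 : 0 ≤ (8 - 9 * h) * (6 * x - 9 * h * y) := by rw [e]; linarith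
      exact nonneg_of_mul_nonneg_right e2 h8
    rw [phip, posp_zero (x := -x) h1 h2 (by right; left; linarith), sub_zero]
    apply max4_eq
    · exact div_nonneg (by linarith) h8.le
    · rw [div_le_iff₀ h8]
      have : 0 ≤ (1 - h) * (2 + y - 3 * x) := mul_nonneg (by linarith) (by linarith)
      linarith
    · rw [div_le_iff₀ h8]
      have : 0 ≤ (6 * x - 9 * h * y + 6 * y - 4) * (6 - 9 * h) :=
          mul_nonneg (by linarith) (by linarith)
      linarith
    · exact le_rfl
    · rw [div_le_div_iff₀ h8 h8']
      have hhy : |h * y| ≤ 1/10 * y := by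
        rw [abs_mul, abs_of_pos hy]
        exact mul_le_mul_of_nonneg_right (abs_le.2 ⟨by linarith, h2⟩) hy.le
      have h3 := abs_le.1 hhy
      have h4 : |2 - 3 * x| ≤ 5 * y := abs_le.2 ⟨by linarith, by linarith⟩
      have h5 : |h * (2 - 3 * x)| ≤ 1/10 * (5 * y) := by
        rw [abs_mul]
        exact mul_le_mul (abs_le.2 ⟨by linarith, h2⟩) h4 (abs_nonneg _) (by norm_num)
      have h6 := abs_le.1 h5
      have h7 : h * h * y ≤ y := by nlinarith
      nlinarith
    · right; right; left; rfl

lemma phiq_mirror : phiq h x y = phiq (-h) (-x) y := by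
  simp only [phiq, posq]
  ring_nf
  simp only [min_comm, min_left_comm, min_assoc]
  
lemma phip_mirror : phip h x y = - phip (-h) (-x) y := by
  have e1 : posp h x y = posp (-h) x (-y) := by
    simp only [posp]
    rw [min_comm (3 * (3 * (1 - h) * (1 - y) - (1 - x)) / (8 - 9 * h))]
    congr 3 <;> ring
  have e2 : posp h (-x) (-y) = posp (-h) (-x) y := by
    simp only [posp]
    rw [min_comm (3 * (3 * (1 - h) * (1 - -y) - (1 - -x)) / (8 - 9 * h))]
    congr 3 <;> ring
  simp only [phip]
  rw [e1, e2]
  simp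

/-- region T4 -/
lemma reg4 (h1 : -1/10 ≤ h) (h2 : h ≤ 1/10) (hy : 0 < y)
    (ha : -(3 * x) < 2 + y) (hb : 4 < -(6 * x - 9 * h * y) + 6 * y)
    (hc : 1 + x < 3 * (1 + h) * (1 - y)) (hd : 8 * x < 3 * h * (2 + y)) :
    phiq h x y = 3 * (2 + y + 3 * x) / (8 + 9 * h) ∧
    phip h x y = -(3 * (3 * (1 + h) * (1 - y) - (1 + x)) / (8 + 9 * h)) := by
  have := reg2 (h := -h) (x := -x) (y := y) (by linarith) (by linarith) hy (by linarith)
    (by linarith) (by linarith) (by linarith)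
  rw [phiq_mirror, phip_mirror, this.1, this.2]
  constructor
  · congr 1 <;> ring
  · congr 2 <;> ring

end hats


/-- `u` is affine near `x` with gradient satisfying `P`. -/
def LocAff (u : E2 → E2) (P : M2 → Prop) (x : E2) : Prop :=
  ∃ G : M2, P G ∧ ∃ b : E2, ∀ᶠ y in nhds x, u y = G *ᵥ y + b

/-- strict subsolutions with bounded second column -/
def KK (m : NNReal) (G : M2) : Prop :=
  G.det = 1 ∧ G 0 0 ^ 2 + G 1 0 ^ 2 < 1 ∧ G 0 1 ^ 2 + G 1 1 ^ 2 < (m : ℝ) ^ 2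

/-- exact solutions -/
def Sol (G : M2) : Prop := G.det = 1 ∧ G 0 0 ^ 2 + G 1 0 ^ 2 = 1

lemma LocAff.isOpen (u : E2 → E2) (P : M2 → Prop) : IsOpen {x | LocAff u P x} := by
  rw [isOpen_iff_mem_nhds]
  rintro x ⟨G, hG, b, hb⟩
  filter_upwards [eventually_eventually_nhds.2 hb] with y hy
  exact ⟨G, hG, b, hy⟩

lemma LocAff.congr {u u' : E2 → E2} {P : M2 → Prop} {x : E2} (h : LocAff u P x)
    (hu : ∀ᶠ y in nhds x, u' y = u y) : LocAff u' P x := by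
  obtain ⟨G, hG, b, hb⟩ := h
  refine ⟨G, hG, b, ?_⟩
  filter_upwards [hb, hu] with y h1 h2
  rw [h2, h1]

lemma LocAff.mono {u : E2 → E2} {P P' : M2 → Prop} {x : E2} (h : LocAff u P x)
    (hP : ∀ G, P G → P' G) : LocAff u P' x := by
  obtain ⟨G, hG, b, hb⟩ := h
  exact ⟨G, hP G hG, b, hb⟩

lemma hasFDerivAt_aff {u : E2 → E2} {x : E2} {G : M2} {b : E2}
    (hb : ∀ᶠ y in nhds x, u y = G *ᵥ y + b) :
    HasFDerivAt u (LinearMap.toContinuousLinearMap (Matrix.toLin' G)) x := by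
  have h1 : HasFDerivAt (fun y : E2 => (LinearMap.toContinuousLinearMap (Matrix.toLin' G)) y + b)
      (LinearMap.toContinuousLinearMap (Matrix.toLin' G)) x :=
    (ContinuousLinearMap.hasFDerivAt _).add_const b
  refine h1.congr_of_eventuallyEq ?_
  filter_upwards [hb] with y hy
  rw [hy]; simp

lemma grad_aff {u : E2 → E2} {x : E2} {G : M2} {b : E2}
    (hb : ∀ᶠ y in nhds x, u y = G *ᵥ y + b) :
    DifferentiableAt ℝ u x ∧ gradMatrix u x = G := by
  have h := hasFDerivAt_aff hb
  refine ⟨h.differentiableAt, ?_⟩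
  rw [gradMatrix, h.fderiv]
  simp

lemma LocAff.diff {u : E2 → E2} {P : M2 → Prop} {x : E2} (h : LocAff u P x) :
    DifferentiableAt ℝ u x ∧ P (gradMatrix u x) := by
  obtain ⟨G, hG, b, hb⟩ := h
  have := grad_aff hb
  exact ⟨this.1, this.2 ▸ hG⟩

lemma LocAff.grad_loc {u : E2 → E2} {P : M2 → Prop} {x : E2} (h : LocAff u P x) :
    ∀ᶠ y in nhds x, gradMatrix u y = gradMatrix u x := by
  obtain ⟨G, hG, b, hb⟩ := h
  filter_upwards [eventually_eventually_nhds.2 hb] with y hy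
  rw [(grad_aff hy).2, (grad_aff hb).2]

lemma LocAff.disj {u : E2 → E2} {x : E2} {m : NNReal} (h : LocAff u (KK m) x) (h' : LocAff u Sol x) :
    False := by
  have h1 := h.diff.2
  have h2 := h'.diff.2
  exact absurd h2.2 h1.2.1.ne

lemma LocAff.scale {g : E2 → E2} {P : M2 → Prop} {c d : E2} {r : ℝ} (hr : 0 < r) {z : E2}
    (h : LocAff g P (r⁻¹ • (z - c))) : LocAff (fun z => r • g (r⁻¹ • (z - c)) + d) P z := by
  obtain ⟨G, hG, b, hb⟩ := h
  have hc : Continuous (fun z : E2 => r⁻¹ • (z - c)) := by fun_prop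
  have := hc.continuousAt.eventually hb
  refine ⟨G, hG, r • b + d - G *ᵥ c, ?_⟩
  filter_upwards [this] with y hy
  rw [hy, smul_add, Matrix.mulVec_smul, smul_smul, mul_inv_cancel₀ hr.ne', one_smul,
    Matrix.mulVec_sub]
  abel

lemma LocAff.lin {g : E2 → E2} {P : M2 → Prop} {R : M2} {z : E2}
    (h : LocAff g P (R *ᵥ z)) :
    LocAff (fun z => g (R *ᵥ z)) (fun G' => ∃ G, P G ∧ G' = G * R) z := by
  obtain ⟨G, hG, b, hb⟩ := h
  have hc : Continuous (fun z : E2 => R *ᵥ z) := by fun_prop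
  have := hc.continuousAt.eventually hb
  refine ⟨G * R, ⟨G, hG, rfl⟩, b, ?_⟩
  filter_upwards [this] with y hy
  rw [hy, Matrix.mulVec_mulVec]

lemma null_line {a b c : ℝ} (h : a ≠ 0 ∨ b ≠ 0) :
    ∀ᵐ z : E2, a * z 0 + b * z 1 ≠ c := by
  let l : E2 →ₗ[ℝ] ℝ := a • LinearMap.proj 0 + b • LinearMap.proj 1
  have hl : ∀ z, l z = a * z 0 + b * z 1 := by intro z; simp [l]
  by_cases hz : ∃ z0 : E2, l z0 = c
  · obtain ⟨z0, hz0⟩ := hz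
    have hne : LinearMap.ker l ≠ ⊤ := by
      intro hk
      rw [LinearMap.ker_eq_top] at hk
      rcases h with h | h
      · have := hl ![1, 0]; rw [hk] at this; simp at this; exact h this.symm
      · have := hl ![0, 1]; rw [hk] at this; simp at this; exact h this.symm
    have h0 : volume ((LinearMap.ker l : Submodule ℝ E2) : Set E2) = 0 :=
      Measure.addHaar_submodule _ _ hne
    have h1 : ∀ᵐ z : E2, z ∉ ((fun w => w + (-z0)) ⁻¹' ((LinearMap.ker l : Submodule ℝ E2) : Set E2)) := by
      rw [ae_iff]; simp only [not_not]
      rw [show {a | a ∈ (fun w : E2 => w + (-z0)) ⁻¹' ((LinearMap.ker l : Submodule ℝ E2) : Set E2)} =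
        (fun w : E2 => w + (-z0)) ⁻¹' ((LinearMap.ker l : Submodule ℝ E2) : Set E2) from rfl,
        measure_preimage_add_right]
      exact h0
    filter_upwards [h1] with z hz heq
    apply hz
    simp [hz0, hl z, heq]
  · push Not at hz
    filter_upwards with z
    rw [← hl]; exact hz z



/-- the list of possible gradients of the hat functions, apart from the corner triangles -/
def Typ (h q1 q2 p1 p2 : ℝ) : Prop :=
  (q1 = 0 ∧ q2 = 0 ∧ p1 = 0 ∧ p2 = 0) ∨
  (q1 = 0 ∧ q2 = 3 / 2 ∧ p1 = 3 / 2 ∧ p2 = -(9 * h / 4)) ∨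
  (q1 = 0 ∧ q2 = -3 ∧ p1 = 0 ∧ p2 = 0) ∨
  (q1 = -(9 / (8 - 9 * h)) ∧ q2 = 3 / (8 - 9 * h) ∧ p1 = 3 / (8 - 9 * h) ∧
    p2 = -(9 * (1 - h) / (8 - 9 * h))) ∨
  (q1 = 9 / (8 + 9 * h) ∧ q2 = 3 / (8 + 9 * h) ∧ p1 = 3 / (8 + 9 * h) ∧
    p2 = 9 * (1 + h) / (8 + 9 * h))

def Typ1 (q1 q2 p1 p2 : ℝ) : Prop := q1 = 0 ∧ q2 = 0 ∧ p1 = -3 ∧ p2 = 0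

def HatAff (h x y q1 q2 p1 p2 : ℝ) : Prop :=
  ∃ q0 p0 : ℝ, ∀ᶠ p : ℝ × ℝ in nhds (x, y),
    phiq h p.1 p.2 = q1 * p.1 + q2 * p.2 + q0 ∧ phip h p.1 p.2 = p1 * p.1 + p2 * p.2 + p0

lemma HatAff.neg {h x y q1 q2 p1 p2 : ℝ} (H : HatAff h (-x) (-y) q1 q2 p1 p2) :
    HatAff h x y q1 q2 p1 p2 := by
  obtain ⟨q0, p0, H⟩ := H
  refine ⟨-q0, -p0, ?_⟩
  have hc : Continuous (fun p : ℝ × ℝ => (-p.1, -p.2)) := by fun_prop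
  have := (hc.continuousAt (x := (x, y))).eventually H
  filter_upwards [this] with p hp
  simp only [phiq_neg, phip_neg] at hp
  constructor <;> linarith [hp.1, hp.2]

lemma ev_lt {f g : ℝ × ℝ → ℝ} {p : ℝ × ℝ} (hf : Continuous f) (hg : Continuous g) (h : f p < g p) :
    ∀ᶠ q in nhds p, f q < g q :=
  (isOpen_lt hf hg).mem_nhds h

lemma hat1 {h x y : ℝ} (h1 : -1/10 ≤ h) (h2 : h ≤ 1/10) (hx : x < 1) (ha : y < 3 * x - 2)
    (hb : -y < 3 * x - 2) : HatAff h x y 0 0 (-3) 0 := by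
  refine ⟨0, 3, ?_⟩
  filter_upwards [ev_lt (p := (x, y)) (f := fun p => p.1) (g := fun _ => 1) (by fun_prop) (by fun_prop) hx,
    ev_lt (p := (x, y)) (f := fun p => p.2) (g := fun p => 3 * p.1 - 2) (by fun_prop) (by fun_prop) ha,
    ev_lt (p := (x, y)) (f := fun p => -p.2) (g := fun p => 3 * p.1 - 2) (by fun_prop) (by fun_prop) hb]
    with p e1 e2 e3
  obtain ⟨a, b⟩ := reg1 h1 h2 e1 e2 e3
  rw [a, b]; constructor <;> ring

lemma hat_out {h x y : ℝ} (h1 : -1/10 ≤ h) (h2 : h ≤ 1/10) (hc : 1 < |x| ∨ 1 < |y|) :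
    HatAff h x y 0 0 0 0 := by
  refine ⟨0, 0, ?_⟩
  have : ∀ᶠ p : ℝ × ℝ in nhds (x, y), 1 ≤ |p.1| ∨ 1 ≤ |p.2| := by
    rcases hc with hc | hc
    · filter_upwards [ev_lt (p := (x, y)) (f := fun _ => 1) (g := fun p => |p.1|) (by fun_prop)
        (by fun_prop) hc] with p hp using Or.inl hp.le
    · filter_upwards [ev_lt (p := (x, y)) (f := fun _ => 1) (g := fun p => |p.2|) (by fun_prop)
        (by fun_prop) hc] with p hp using Or.inr hp.le
  filter_upwards [this] with p hp
  rw [phiq_out h1 h2 hp, phip_out h1 h2 hp]; constructor <;> ring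

lemma hatP {h x y : ℝ} (h1 : -1/10 ≤ h) (h2 : h ≤ 1/10) (hy : 0 < y)
    (ha : 6 * x - 9 * h * y + 6 * y < 4) (hb : -(6 * x - 9 * h * y) + 6 * y < 4) :
    HatAff h x y 0 (3 / 2) (3 / 2) (-(9 * h / 4)) := by
  refine ⟨0, 0, ?_⟩
  filter_upwards [ev_lt (p := (x, y)) (f := fun _ => 0) (g := fun p => p.2) (by fun_prop) (by fun_prop) hy,
    ev_lt (p := (x, y)) (f := fun p => 6 * p.1 - 9 * h * p.2 + 6 * p.2) (g := fun _ => 4) (by fun_prop) (by fun_prop) ha,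
    ev_lt (p := (x, y)) (f := fun p => -(6 * p.1 - 9 * h * p.2) + 6 * p.2) (g := fun _ => 4) (by fun_prop) (by fun_prop) hb]
    with p e1 e2 e3
  obtain ⟨a, b⟩ := regP h1 h2 e1 e2 e3
  rw [a, b]; constructor <;> ring

lemma hat3 {h x y : ℝ} (h1 : -1/10 ≤ h) (h2 : h ≤ 1/10) (hy : y < 1) (hy' : 2/3 < y)
    (ha : 3 * (1 - h) * (1 - y) < 1 - x) (hb : 3 * (1 + h) * (1 - y) < 1 + x) :
    HatAff h x y 0 (-3) 0 0 := by
  refine ⟨3, 0, ?_⟩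
  filter_upwards [ev_lt (p := (x, y)) (f := fun p => p.2) (g := fun _ => 1) (by fun_prop) (by fun_prop) hy,
    ev_lt (p := (x, y)) (f := fun _ => 2/3) (g := fun p => p.2) (by fun_prop) (by fun_prop) hy',
    ev_lt (p := (x, y)) (f := fun p => 3 * (1 - h) * (1 - p.2)) (g := fun p => 1 - p.1) (by fun_prop) (by fun_prop) ha,
    ev_lt (p := (x, y)) (f := fun p => 3 * (1 + h) * (1 - p.2)) (g := fun p => 1 + p.1) (by fun_prop) (by fun_prop) hb]
    with p e1 e2 e3 e4
  obtain ⟨a, b⟩ := reg3 h1 h2 e1 e2 e3 e4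
  rw [a, b]; constructor <;> ring

lemma hat2 {h x y : ℝ} (h1 : -1/10 ≤ h) (h2 : h ≤ 1/10) (hy : 0 < y) (ha : 3 * x < 2 + y)
    (hb : 4 < 6 * x - 9 * h * y + 6 * y) (hc : 1 - x < 3 * (1 - h) * (1 - y))
    (hd : 3 * h * (2 + y) < 8 * x) :
    HatAff h x y (-(9 / (8 - 9 * h))) (3 / (8 - 9 * h)) (3 / (8 - 9 * h))
      (-(9 * (1 - h) / (8 - 9 * h))) := by
  refine ⟨6 / (8 - 9 * h), (9 * (1 - h) - 3) / (8 - 9 * h), ?_⟩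
  filter_upwards [ev_lt (p := (x, y)) (f := fun _ => 0) (g := fun p => p.2) (by fun_prop) (by fun_prop) hy,
    ev_lt (p := (x, y)) (f := fun p => 3 * p.1) (g := fun p => 2 + p.2) (by fun_prop) (by fun_prop) ha,
    ev_lt (p := (x, y)) (f := fun _ => 4) (g := fun p => 6 * p.1 - 9 * h * p.2 + 6 * p.2) (by fun_prop) (by fun_prop) hb,
    ev_lt (p := (x, y)) (f := fun p => 1 - p.1) (g := fun p => 3 * (1 - h) * (1 - p.2)) (by fun_prop) (by fun_prop) hc,
    ev_lt (p := (x, y)) (f := fun p => 3 * h * (2 + p.2)) (g := fun p => 8 * p.1) (by fun_prop) (by fun_prop) hd]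
    with p e1 e2 e3 e4 e5
  obtain ⟨a, b⟩ := reg2 h1 h2 e1 e2 e3 e4 e5
  have : 8 - 9 * h ≠ 0 := by linarith
  rw [a, b]; constructor <;> field_simp <;> ring

lemma hat4 {h x y : ℝ} (h1 : -1/10 ≤ h) (h2 : h ≤ 1/10) (hy : 0 < y) (ha : -(3 * x) < 2 + y)
    (hb : 4 < -(6 * x - 9 * h * y) + 6 * y) (hc : 1 + x < 3 * (1 + h) * (1 - y))
    (hd : 8 * x < 3 * h * (2 + y)) :
    HatAff h x y (9 / (8 + 9 * h)) (3 / (8 + 9 * h)) (3 / (8 + 9 * h))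
      (9 * (1 + h) / (8 + 9 * h)) := by
  refine ⟨6 / (8 + 9 * h), -(9 * (1 + h) - 3) / (8 + 9 * h), ?_⟩
  filter_upwards [ev_lt (p := (x, y)) (f := fun _ => 0) (g := fun p => p.2) (by fun_prop) (by fun_prop) hy,
    ev_lt (p := (x, y)) (f := fun p => -(3 * p.1)) (g := fun p => 2 + p.2) (by fun_prop) (by fun_prop) ha,
    ev_lt (p := (x, y)) (f := fun _ => 4) (g := fun p => -(6 * p.1 - 9 * h * p.2) + 6 * p.2) (by fun_prop) (by fun_prop) hb,
    ev_lt (p := (x, y)) (f := fun p => 1 + p.1) (g := fun p => 3 * (1 + h) * (1 - p.2)) (by fun_prop) (by fun_prop) hc,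
    ev_lt (p := (x, y)) (f := fun p => 8 * p.1) (g := fun p => 3 * h * (2 + p.2)) (by fun_prop) (by fun_prop) hd]
    with p e1 e2 e3 e4 e5
  obtain ⟨a, b⟩ := reg4 h1 h2 e1 e2 e3 e4 e5
  have : 8 + 9 * h ≠ 0 := by linarith
  rw [a, b]; constructor <;> field_simp <;> ring

/-- genericity of a point -/
def Gen (h x y : ℝ) : Prop :=
  (0 * x + 1 * y ≠ 0 ∧ 1 * x + 0 * y ≠ 1 ∧ 1 * x + 0 * y ≠ -1 ∧ 0 * x + 1 * y ≠ 1) ∧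
  (3 * x + (-1) * y ≠ 2 ∧ (-3) * x + (-1) * y ≠ 2 ∧ 0 * x + 1 * y ≠ 2 / 3) ∧
  (6 * x + (6 - 9 * h) * y ≠ 4 ∧ (-6) * x + (6 + 9 * h) * y ≠ 4) ∧
  (1 * x + (-(3 * (1 - h))) * y ≠ 1 - 3 * (1 - h) ∧ (-1) * x + (-(3 * (1 + h))) * y ≠ 1 - 3 * (1 + h)) ∧
  (8 * x + (-(3 * h)) * y ≠ 6 * h)

lemma hat_pos {h x y : ℝ} (h1 : -1/10 ≤ h) (h2 : h ≤ 1/10) (hy : 0 < y) (hg : Gen h x y) :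
    ∃ q1 q2 p1 p2, HatAff h x y q1 q2 p1 p2 ∧ (Typ h q1 q2 p1 p2 ∨ Typ1 q1 q2 p1 p2) := by
  obtain ⟨⟨-, g2, g3, g4⟩, ⟨g5, g6, g7⟩, ⟨g8, g9⟩, ⟨g10, g11⟩, g12⟩ := hg
  have k2 : x ≠ 1 := fun e => g2 (by linarith)
  have k3 : x ≠ -1 := fun e => g3 (by linarith)
  have k4 : y ≠ 1 := fun e => g4 (by linarith)
  rcases lt_or_gt_of_ne k4 with l4 | l4
  swap
  · exact ⟨_, _, _, _, hat_out h1 h2 (Or.inr (by rwa [abs_of_pos hy])), Or.inl (Or.inl ⟨rfl, rfl, rfl, rfl⟩)⟩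
  rcases lt_or_gt_of_ne k2 with l2 | l2
  swap
  · exact ⟨_, _, _, _, hat_out h1 h2 (Or.inl (lt_abs.2 (Or.inl l2))), Or.inl (Or.inl ⟨rfl, rfl, rfl, rfl⟩)⟩
  rcases lt_or_gt_of_ne k3 with l3 | l3
  · exact ⟨_, _, _, _, hat_out h1 h2 (Or.inl (lt_abs.2 (Or.inr (by linarith)))), Or.inl (Or.inl ⟨rfl, rfl, rfl, rfl⟩)⟩
  rcases lt_or_gt_of_ne g5 with l5 | l5
  swap
  · exact ⟨_, _, _, _, hat1 h1 h2 l2 (by linarith) (by linarith), Or.inr ⟨rfl, rfl, rfl, rfl⟩⟩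
  rcases lt_or_gt_of_ne g6 with l6 | l6
  swap
  · exact ⟨_, _, _, _, (hat1 (x := -x) (y := -y) h1 h2 (by linarith) (by linarith) (by linarith)).neg, Or.inr ⟨rfl, rfl, rfl, rfl⟩⟩
  have hP : 6 * x + (6 - 9 * h) * y < 4 → (-6) * x + (6 + 9 * h) * y < 4 → ∃ q1 q2 p1 p2, HatAff h x y q1 q2 p1 p2 ∧ (Typ h q1 q2 p1 p2 ∨ Typ1 q1 q2 p1 p2) := fun a b =>
    ⟨_, _, _, _, hatP h1 h2 hy (by linarith) (by linarith), Or.inl (Or.inr (Or.inl ⟨rfl, rfl, rfl, rfl⟩))⟩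
  have h3 : 2 / 3 < y → 1 * x + (-(3 * (1 - h))) * y < 1 - 3 * (1 - h) → (-1) * x + (-(3 * (1 + h))) * y < 1 - 3 * (1 + h) → ∃ q1 q2 p1 p2, HatAff h x y q1 q2 p1 p2 ∧ (Typ h q1 q2 p1 p2 ∨ Typ1 q1 q2 p1 p2) := fun a b c =>
    ⟨_, _, _, _, hat3 h1 h2 l4 a (by linarith) (by linarith), Or.inl (Or.inr (Or.inr (Or.inl ⟨rfl, rfl, rfl, rfl⟩)))⟩
  have hh2 : 4 < 6 * x + (6 - 9 * h) * y → 1 - 3 * (1 - h) < 1 * x + (-(3 * (1 - h))) * y → 6 * h < 8 * x + (-(3 * h)) * y → ∃ q1 q2 p1 p2, HatAff h x y q1 q2 p1 p2 ∧ (Typ h q1 q2 p1 p2 ∨ Typ1 q1 q2 p1 p2) := fun a b c =>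
    ⟨_, _, _, _, hat2 h1 h2 hy (by linarith) (by linarith) (by linarith) (by linarith), Or.inl (Or.inr (Or.inr (Or.inr (Or.inl ⟨rfl, rfl, rfl, rfl⟩))))⟩
  have hh4 : 4 < (-6) * x + (6 + 9 * h) * y → 1 - 3 * (1 + h) < (-1) * x + (-(3 * (1 + h))) * y → 8 * x + (-(3 * h)) * y < 6 * h → ∃ q1 q2 p1 p2, HatAff h x y q1 q2 p1 p2 ∧ (Typ h q1 q2 p1 p2 ∨ Typ1 q1 q2 p1 p2) := fun a b c =>
    ⟨_, _, _, _, hat4 h1 h2 hy (by linarith) (by linarith) (by linarith) (by linarith), Or.inl (Or.inr (Or.inr (Or.inr (Or.inr ⟨rfl, rfl, rfl, rfl⟩))))⟩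
  -- decide by the smallest of the four linear forms
  rcases lt_or_gt_of_ne g8 with l8 | l8 <;> rcases lt_or_gt_of_ne g9 with l9 | l9
  · exact hP l8 l9
  · rcases lt_or_gt_of_ne g12 with l12 | l12
    · rcases lt_or_gt_of_ne g11 with l11 | l11
      · have e7 : 2 / 3 < y := by nlinarith
        refine h3 e7 ?_ l11
        nlinarith
      · exact hh4 l9 l11 l12
    · exfalso; nlinarith
  · rcases lt_or_gt_of_ne g12 with l12 | l12
    · exfalso; nlinarith
    · rcases lt_or_gt_of_ne g10 with l10 | l10
      · have e7 : 2 / 3 < y := by nlinarith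
        refine h3 e7 l10 ?_
        nlinarith
      · exact hh2 l8 l10 l12
  · rcases lt_or_gt_of_ne g12 with l12 | l12
    · rcases lt_or_gt_of_ne g11 with l11 | l11
      · have e7 : 2 / 3 < y := by nlinarith
        refine h3 e7 ?_ l11
        nlinarith
      · exact hh4 l9 l11 l12
    · rcases lt_or_gt_of_ne g10 with l10 | l10
      · have e7 : 2 / 3 < y := by nlinarith
        refine h3 e7 l10 ?_
        nlinarith
      · exact hh2 l8 l10 l12

lemma hat_gen {h x y : ℝ} (h1 : -1/10 ≤ h) (h2 : h ≤ 1/10) (hg : Gen h x y) (hg' : Gen h (-x) (-y)) :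
    ∃ q1 q2 p1 p2, HatAff h x y q1 q2 p1 p2 ∧ (Typ h q1 q2 p1 p2 ∨ Typ1 q1 q2 p1 p2) := by
  have hy : y ≠ 0 := fun e => hg.1.1 (by linarith)
  rcases lt_or_gt_of_ne hy with l | l
  · obtain ⟨q1, q2, p1, p2, a, b⟩ := hat_pos (y := -y) h1 h2 (by linarith) hg'
    exact ⟨q1, q2, p1, p2, a.neg, b⟩
  · exact hat_pos h1 h2 l hg

lemma ae_gen {h k σ : ℝ} (hk : 0 < k) (hσ : σ ≠ 0) : ∀ᵐ z : E2, Gen h (σ * (z 0 / k)) (σ * z 1) := by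
  have key : ∀ a b c : ℝ, (a ≠ 0 ∨ b ≠ 0) → ∀ᵐ z : E2, a * (σ * (z 0 / k)) + b * (σ * z 1) ≠ c := by
    intro a b c hab
    have := null_line (a := a * σ / k) (b := b * σ) (c := c) (by
      rcases hab with h | h
      · left; positivity
      · right; positivity)
    filter_upwards [this] with z hz
    intro e; apply hz; rw [← e]; ring
  unfold Gen
  simp only [Filter.eventually_and]
  refine ⟨⟨?_, ?_, ?_, ?_⟩, ⟨?_, ?_, ?_⟩, ⟨?_, ?_⟩, ⟨?_, ?_⟩, ?_⟩ <;> apply key <;> norm_num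



lemma lin_le {a b u v d C : ℝ} (hu : |u| ≤ d) (hv : |v| ≤ d) (hab : |a| + |b| ≤ C) :
    |a * u + b * v| ≤ C * d := by
  have hd : 0 ≤ d := (abs_nonneg _).trans hu
  calc |a * u + b * v| ≤ |a| * |u| + |b| * |v| := by
        rw [← abs_mul, ← abs_mul]; exact abs_add_le _ _
    _ ≤ |a| * d + |b| * d := by gcongr
    _ = (|a| + |b|) * d := by ring
    _ ≤ C * d := by gcongr

lemma posq_lip {h x y x' y' d : ℝ} (h1 : -1/10 ≤ h) (h2 : h ≤ 1/10) (hx : |x - x'| ≤ d)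
    (hy : |y - y'| ≤ d) : |posq h x y - posq h x' y'| ≤ 3 * d := by
  have p1 : 0 < 8 - 9 * h := by linarith
  have p2 : 0 < 8 + 9 * h := by linarith
  apply max4_lip
  · convert lin_le (a := 0) (b := 3 / 2) hx hy (C := 3) (by norm_num [abs_of_pos]) using 2; ring
  · convert lin_le (a := 0) (b := -3) hx hy (C := 3) (by norm_num) using 2; ring
  · convert lin_le (a := -(9 / (8 - 9 * h))) (b := 3 / (8 - 9 * h)) hx hy (C := 3) (by
      rw [abs_neg, abs_of_pos (by positivity), abs_of_pos (by positivity), ← add_div, div_le_iff₀ p1]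
      linarith) using 2
    field_simp; ring
  · convert lin_le (a := (9 / (8 + 9 * h))) (b := 3 / (8 + 9 * h)) hx hy (C := 3) (by
      rw [abs_of_pos (by positivity), abs_of_pos (by positivity), ← add_div, div_le_iff₀ p2]
      linarith) using 2
    field_simp; ring

lemma posp_lip {h x y x' y' d : ℝ} (h1 : -1/10 ≤ h) (h2 : h ≤ 1/10) (hx : |x - x'| ≤ d)
    (hy : |y - y'| ≤ d) : |posp h x y - posp h x' y'| ≤ 3 * d := by
  have p1 : 0 < 8 - 9 * h := by linarith
  have p2 : 0 < 8 + 9 * h := by linarith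
  have p3 : 0 < 1 - h := by linarith
  have p4 : 0 < 1 + h := by linarith
  apply max4_lip
  · convert lin_le (a := -3) (b := 0) hx hy (C := 3) (by norm_num) using 2; ring
  · convert lin_le (a := 3 / 2) (b := -(9 * h / 4)) hx hy (C := 3) (by
      have : |-(9 * h / 4)| ≤ 1 := abs_le.2 ⟨by linarith, by linarith⟩
      rw [abs_of_pos (by norm_num : (0:ℝ) < 3 / 2)]; linarith) using 2; ring
  · convert lin_le (a := 3 / (8 - 9 * h)) (b := -(9 * (1 - h) / (8 - 9 * h))) hx hy (C := 3) (by
      rw [abs_neg, abs_of_pos (by positivity), abs_of_pos (by positivity), ← add_div, div_le_iff₀ p1]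
      linarith) using 2
    field_simp; ring
  · convert lin_le (a := 3 / (8 + 9 * h)) (b := 9 * (1 + h) / (8 + 9 * h)) hx hy (C := 3) (by
      rw [abs_of_pos (by positivity), abs_of_pos (by positivity), ← add_div, div_le_iff₀ p2]
      linarith) using 2
    field_simp; ring

lemma phiq_lip {h x y x' y' d : ℝ} (h1 : -1/10 ≤ h) (h2 : h ≤ 1/10) (hx : |x - x'| ≤ d)
    (hy : |y - y'| ≤ d) : |phiq h x y - phiq h x' y'| ≤ 6 * d := by
  have a := posq_lip h1 h2 hx hy
  have b := posq_lip (x := -x) (y := -y) (x' := -x') (y' := -y') h1 h2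
    (d := d) (by rwa [neg_sub_neg, abs_sub_comm]) (by rwa [neg_sub_neg, abs_sub_comm])
  unfold phiq
  rw [abs_le] at *
  constructor <;> linarith [a.1, a.2, b.1, b.2]

lemma phip_lip {h x y x' y' d : ℝ} (h1 : -1/10 ≤ h) (h2 : h ≤ 1/10) (hx : |x - x'| ≤ d)
    (hy : |y - y'| ≤ d) : |phip h x y - phip h x' y'| ≤ 6 * d := by
  have a := posp_lip h1 h2 hx hy
  have b := posp_lip (x := -x) (y := -y) (x' := -x') (y' := -y') h1 h2
    (d := d) (by rwa [neg_sub_neg, abs_sub_comm]) (by rwa [neg_sub_neg, abs_sub_comm])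
  unfold phip
  rw [abs_le] at *
  constructor <;> linarith [a.1, a.2, b.1, b.2]

/-- choice of the shear parameter -/
lemma exists_shear {m : NNReal} {G : M2} (hG : KK m G) : ∃ s : ℝ,
    (G 0 0 + s * G 0 1) ^ 2 + (G 1 0 + s * G 1 1) ^ 2 = 1 ∧
    ∀ t, |t| < |s| → (G 0 0 + t * G 0 1) ^ 2 + (G 1 0 + t * G 1 1) ^ 2 < 1 ∧ s ≠ 0 := by
  obtain ⟨hd, h1, -⟩ := hG
  rw [Matrix.det_fin_two] at hd
  set A := G 0 1 ^ 2 + G 1 1 ^ 2 with hA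
  set B := G 0 0 * G 0 1 + G 1 0 * G 1 1 with hB
  set C := G 0 0 ^ 2 + G 1 0 ^ 2 with hC
  have hN : ∀ t, (G 0 0 + t * G 0 1) ^ 2 + (G 1 0 + t * G 1 1) ^ 2 = A * t ^ 2 + 2 * B * t + C := by
    intro t; rw [hA, hB, hC]; ring
  have hApos : 0 < A := by
    by_contra hcon
    have e1 : G 0 1 = 0 := by nlinarith [sq_nonneg (G 0 1), sq_nonneg (G 1 1)]
    have e2 : G 1 1 = 0 := by nlinarith [sq_nonneg (G 0 1), sq_nonneg (G 1 1)]
    rw [e1, e2] at hd; norm_num at hd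
  obtain ⟨s0, hs0, hroot⟩ : ∃ s0 : ℝ, 0 < s0 ∧ A * s0 ^ 2 + 2 * |B| * s0 + C = 1 := by
    have hD : 0 ≤ |B| ^ 2 + A * (1 - C) := by
      have : 0 ≤ A * (1 - C) := mul_nonneg hApos.le (by linarith)
      positivity
    have hsq := Real.sq_sqrt hD
    have hlt : |B| < √(|B| ^ 2 + A * (1 - C)) := by
      apply Real.lt_sqrt_of_sq_lt
      have : 0 < A * (1 - C) := mul_pos hApos (by linarith)
      linarith
    set D := √(|B| ^ 2 + A * (1 - C))
    refine ⟨(D - |B|) / A, div_pos (by linarith) hApos, ?_⟩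
    field_simp
    nlinarith
  have key : ∀ t, |t| < s0 → A * t ^ 2 + 2 * B * t + C < 1 := by
    intro t ht
    have : B * t ≤ |B| * |t| := by rw [← abs_mul]; exact le_abs_self _
    have h2 : |B| * |t| ≤ |B| * s0 := by gcongr
    have h3 : t ^ 2 < s0 ^ 2 := by rw [← sq_abs t]; gcongr
    have h4 := mul_lt_mul_of_pos_left h3 hApos
    linarith
  rcases le_total 0 B with hb | hb
  · refine ⟨s0, ?_, ?_⟩
    · rw [hN, ← hroot, abs_of_nonneg hb]
    · intro t ht
      rw [abs_of_pos hs0] at ht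
      rw [hN]; exact ⟨key t ht, hs0.ne'⟩
  · refine ⟨-s0, ?_, ?_⟩
    · rw [hN, ← hroot, abs_of_nonpos hb]; ring
    · intro t ht
      rw [abs_neg, abs_of_pos hs0] at ht
      rw [hN]; exact ⟨key t ht, by have := hs0.ne'; linarith⟩

/-- gradient of the block map -/
def Dw (k h q1 q2 p1 p2 : ℝ) : M2 := !![1 - h * q1, -(k * h * q2); h * p1 / k, 1 + h * p2]

lemma ev_type {m : NNReal} {G : M2} (hG : KK m G) (s : ℝ) (q1 q2 p1 p2 : ℝ → ℝ)
    (c1 : ContinuousAt q1 0) (c2 : ContinuousAt q2 0) (c3 : ContinuousAt p1 0)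
    (c4 : ContinuousAt p2 0)
    (hs : (G 0 0 + (-(s / 3) * p1 0) * G 0 1) ^ 2 + (G 1 0 + (-(s / 3) * p1 0) * G 1 1) ^ 2 < 1)
    (hdet : ∀ᶠ h in nhds (0:ℝ), (1 - h * q1 h) * (1 + h * p2 h) + h ^ 2 * q2 h * p1 h = 1) :
    ∀ᶠ k in nhdsWithin (0:ℝ) (Ioi 0),
      KK m (G * Dw k (-(k * s / 3)) (q1 (-(k * s / 3))) (q2 (-(k * s / 3))) (p1 (-(k * s / 3)))
        (p2 (-(k * s / 3)))) := by
  have hc : Continuous (fun k : ℝ => -(k * s / 3)) := by fun_prop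
  have h0 : (fun k : ℝ => -(k * s / 3)) 0 = 0 := by simp
  have ht : Filter.Tendsto (fun k : ℝ => -(k * s / 3)) (nhds 0) (nhds 0) := by
    have := hc.tendsto 0; simpa using this
  have d1 : ContinuousAt (fun k : ℝ => q1 (-(k * s / 3))) 0 :=
    ContinuousAt.comp (f := fun k : ℝ => -(k * s / 3)) (by simpa using c1) hc.continuousAt
  have d2 : ContinuousAt (fun k : ℝ => q2 (-(k * s / 3))) 0 :=
    ContinuousAt.comp (f := fun k : ℝ => -(k * s / 3)) (by simpa using c2) hc.continuousAt
  have d3 : ContinuousAt (fun k : ℝ => p1 (-(k * s / 3))) 0 :=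
    ContinuousAt.comp (f := fun k : ℝ => -(k * s / 3)) (by simpa using c3) hc.continuousAt
  have d4 : ContinuousAt (fun k : ℝ => p2 (-(k * s / 3))) 0 :=
    ContinuousAt.comp (f := fun k : ℝ => -(k * s / 3)) (by simpa using c4) hc.continuousAt
  have f1 : ContinuousAt (fun k : ℝ =>
      (G 0 0 * (1 - -(k * s / 3) * q1 (-(k * s / 3))) + G 0 1 * (-(s / 3) * p1 (-(k * s / 3)))) ^ 2 +
      (G 1 0 * (1 - -(k * s / 3) * q1 (-(k * s / 3))) + G 1 1 * (-(s / 3) * p1 (-(k * s / 3)))) ^ 2) 0 := by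
    have cont : ∀ a b : ℝ → ℝ, ContinuousAt a 0 → ContinuousAt b 0 → ContinuousAt (fun k : ℝ =>
      (G 0 0 * (1 - -(k * s / 3) * a k) + G 0 1 * (-(s / 3) * b k)) ^ 2 +
      (G 1 0 * (1 - -(k * s / 3) * a k) + G 1 1 * (-(s / 3) * b k)) ^ 2) 0 := by
      intro a b ha hb
      fun_prop (disch := norm_num)
    exact cont _ _ d1 d3
  have f2 : ContinuousAt (fun k : ℝ =>
      (G 0 0 * (-(k * -(k * s / 3) * q2 (-(k * s / 3)))) + G 0 1 * (1 + -(k * s / 3) * p2 (-(k * s / 3)))) ^ 2 +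
      (G 1 0 * (-(k * -(k * s / 3) * q2 (-(k * s / 3)))) + G 1 1 * (1 + -(k * s / 3) * p2 (-(k * s / 3)))) ^ 2) 0 := by
    have cont : ∀ a b : ℝ → ℝ, ContinuousAt a 0 → ContinuousAt b 0 → ContinuousAt (fun k : ℝ =>
      (G 0 0 * (-(k * -(k * s / 3) * a k)) + G 0 1 * (1 + -(k * s / 3) * b k)) ^ 2 +
      (G 1 0 * (-(k * -(k * s / 3) * a k)) + G 1 1 * (1 + -(k * s / 3) * b k)) ^ 2) 0 := by
      intro a b ha hb
      fun_prop (disch := norm_num)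
    exact cont _ _ d2 d4
  have g1 := f1.eventually_lt (g := fun _ => (1:ℝ)) continuousAt_const (by
    simp only [zero_mul, zero_div, neg_zero, sub_zero, mul_one]
    refine lt_of_eq_of_lt ?_ hs; ring)
  have g2 := f2.eventually_lt (g := fun _ => (m:ℝ) ^ 2) continuousAt_const (by
    simp only [zero_mul, zero_div, neg_zero, add_zero, mul_one, mul_zero, zero_add]
    exact hG.2.2)
  filter_upwards [nhdsWithin_le_nhds g1, nhdsWithin_le_nhds g2, nhdsWithin_le_nhds (ht.eventually hdet),
    self_mem_nhdsWithin] with k e1 e2 e3 hk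
  have hk0 : k ≠ 0 := ne_of_gt hk
  refine ⟨?_, ?_, ?_⟩
  · rw [Matrix.det_mul, hG.1, one_mul, Dw, Matrix.det_fin_two_of]
    refine Eq.trans ?_ e3
    have : ∀ P R : ℝ, -(k * -(k * s / 3) * R) * (-(k * s / 3) * P / k) = -((-(k * s / 3)) ^ 2 * R * P) := by
      intro P R; field_simp
    rw [this]
    ring
  · refine lt_of_eq_of_lt ?_ e1
    simp only [Dw, Matrix.mul_apply, Fin.sum_univ_two, Matrix.of_apply, Matrix.cons_val_zero, Matrix.cons_val_one, Matrix.cons_val_zero, Matrix.cons_val', Matrix.cons_val_fin_one]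
    have : ∀ P : ℝ, -(k * s / 3) * P / k = -(s / 3) * P := by intro P; field_simp
    rw [this]
  · refine lt_of_eq_of_lt ?_ e2
    simp only [Dw, Matrix.mul_apply, Fin.sum_univ_two, Matrix.of_apply, Matrix.cons_val_zero, Matrix.cons_val_one, Matrix.cons_val_zero, Matrix.cons_val', Matrix.cons_val_fin_one]



/-- the block map -/
def blk (G : M2) (k h : ℝ) (z : E2) : E2 :=
  G *ᵥ ![z 0 - k * h * phiq h (z 0 / k) (z 1), z 1 + h * phip h (z 0 / k) (z 1)]

lemma blk_locaff {G : M2} {k h : ℝ} (hk : 0 < k) {z : E2} {q1 q2 p1 p2 : ℝ}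
    (H : HatAff h (z 0 / k) (z 1) q1 q2 p1 p2) {P : M2 → Prop} (hP : P (G * Dw k h q1 q2 p1 p2)) :
    LocAff (blk G k h) P z := by
  obtain ⟨q0, p0, H⟩ := H
  have hc : Continuous (fun z : E2 => (z 0 / k, z 1)) := by fun_prop
  have := (hc.continuousAt (x := z)).eventually H
  refine ⟨_, hP, G *ᵥ ![-(k * h * q0), h * p0], ?_⟩
  filter_upwards [this] with w hw
  rw [blk, hw.1, hw.2, ← Matrix.mulVec_mulVec, ← Matrix.mulVec_add]
  congr 1
  ext i
  fin_cases i
  · simp [Dw, dotProduct, Fin.sum_univ_two]; field_simp; ring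
  · simp [Dw, dotProduct, Fin.sum_univ_two]; field_simp; ring

lemma KK.entry {m : NNReal} {G : M2} (hG : KK m G) (i : Fin 2) : |G i 0| ≤ 1 ∧ |G i 1| ≤ m := by
  obtain ⟨-, h1, h2⟩ := hG
  constructor
  · apply abs_le_of_sq_le_sq _ zero_le_one
    fin_cases i
    · show G 0 0 ^ 2 ≤ 1 ^ 2
      nlinarith [sq_nonneg (G 1 0)]
    · show G 1 0 ^ 2 ≤ 1 ^ 2
      nlinarith [sq_nonneg (G 0 0)]
  · apply abs_le_of_sq_le_sq _ m.2
    fin_cases i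
    · show G 0 1 ^ 2 ≤ (m : ℝ) ^ 2
      nlinarith [sq_nonneg (G 1 1)]
    · show G 1 1 ^ 2 ≤ (m : ℝ) ^ 2
      nlinarith [sq_nonneg (G 0 1)]

lemma blk_lip {m : NNReal} {G : M2} (hG : KK m G) {k s : ℝ} (hk : 0 < k) (hk1 : k ≤ 1)
    (h1 : -1/10 ≤ -(k * s / 3)) (h2 : -(k * s / 3) ≤ 1/10)
    (hs : (G 0 0 + s * G 0 1) ^ 2 + (G 1 0 + s * G 1 1) ^ 2 = 1) :
    LipschitzWith (m + 6) (blk G k (-(k * s / 3))) := by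
  apply LipschitzWith.of_dist_le_mul
  intro z w
  set d := dist z w with hd
  have hd0 : 0 ≤ d := dist_nonneg
  have e0 : |z 0 - w 0| ≤ d := dist_le_pi_dist z w 0
  have e1 : |z 1 - w 1| ≤ d := dist_le_pi_dist z w 1
  have e0' : |z 0 / k - w 0 / k| ≤ d / k := by
    rw [← sub_div, abs_div, abs_of_pos hk]; gcongr
  have e1' : |z 1 - w 1| ≤ d / k := e1.trans (by rw [le_div_iff₀ hk]; nlinarith)
  have a := phiq_lip h1 h2 e0' e1'
  have b := phip_lip h1 h2 e0' e1'
  have hse : ∀ i, |s * G i 1| ≤ 2 := by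
    intro i
    have hc := (hG.entry i).1
    have : |G i 0 + s * G i 1| ≤ 1 := by
      apply abs_le_of_sq_le_sq _ zero_le_one
      fin_cases i
      · show (G 0 0 + s * G 0 1) ^ 2 ≤ 1 ^ 2
        nlinarith [sq_nonneg (G 1 0 + s * G 1 1)]
      · show (G 1 0 + s * G 1 1) ^ 2 ≤ 1 ^ 2
        nlinarith [sq_nonneg (G 0 0 + s * G 0 1)]
    rw [abs_le] at *
    constructor <;> linarith [hc.1, hc.2, this.1, this.2]
  rw [dist_pi_le_iff (by positivity)]
  intro i
  rw [Real.dist_eq]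
  set h := -(k * s / 3) with hh
  obtain ⟨c0, c1⟩ := hG.entry i
  have hhab : |h| ≤ 1/10 := abs_le.2 ⟨by linarith, h2⟩
  have E : blk G k h z i - blk G k h w i =
      G i 0 * (z 0 - w 0) + (-(G i 0 * h)) * (k * (phiq h (z 0 / k) (z 1) - phiq h (w 0 / k) (w 1)))
      + G i 1 * (z 1 - w 1) + (-(s * G i 1) / 3) * (k * (phip h (z 0 / k) (z 1) - phip h (w 0 / k) (w 1))) := by
    simp only [blk, Matrix.mulVec, dotProduct, Fin.sum_univ_two, Matrix.cons_val_zero, Matrix.cons_val_one, Matrix.cons_val_fin_one]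
    rw [show h = -(k * s / 3) from rfl]; ring
  have ka : |k * (phiq h (z 0 / k) (z 1) - phiq h (w 0 / k) (w 1))| ≤ 6 * d := by
    rw [abs_mul, abs_of_pos hk]
    calc _ ≤ k * (6 * (d / k)) := by gcongr
      _ = 6 * d := by field_simp
  have kb : |k * (phip h (z 0 / k) (z 1) - phip h (w 0 / k) (w 1))| ≤ 6 * d := by
    rw [abs_mul, abs_of_pos hk]
    calc _ ≤ k * (6 * (d / k)) := by gcongr
      _ = 6 * d := by field_simp
  rw [E]
  have t1 : |G i 0 * (z 0 - w 0)| ≤ 1 * d := by rw [abs_mul]; gcongr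
  have t2 : |(-(G i 0 * h)) * (k * (phiq h (z 0 / k) (z 1) - phiq h (w 0 / k) (w 1)))| ≤ (1 * (1/10)) * (6 * d) := by
    rw [abs_mul, abs_neg, abs_mul]; gcongr
  have t3 : |G i 1 * (z 1 - w 1)| ≤ m * d := by rw [abs_mul]; gcongr
  have t4 : |(-(s * G i 1) / 3) * (k * (phip h (z 0 / k) (z 1) - phip h (w 0 / k) (w 1)))| ≤ (2 / 3) * (6 * d) := by
    rw [abs_mul, abs_div, abs_neg, abs_of_pos (by norm_num : (0:ℝ) < 3)]; gcongr; exact hse i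
  push_cast
  refine (abs_add_le _ _).trans ?_
  refine (add_le_add_left ((abs_add_le _ _).trans (add_le_add_left (abs_add_le _ _) _)) _).trans ?_
  linarith

lemma block {m : NNReal} {G : M2} (hG : KK m G) : ∃ n : ℕ, ∃ g : E2 → E2,
    LipschitzWith (m + 6) g ∧
    (∀ z : E2, (1 / ((n : ℝ) + 1) ≤ |z 0| ∨ 1 ≤ |z 1|) → g z = G *ᵥ z) ∧
    (∀ᵐ z : E2, LocAff g (KK m) z ∨ LocAff g Sol z) ∧
    ∀ z : E2, 5 / 6 * (1 / ((n : ℝ) + 1)) < z 0 → z 0 < 1 / ((n : ℝ) + 1) → |z 1| < 1 / 2 →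
      LocAff g Sol z := by
  obtain ⟨s, hs, hst⟩ := exists_shear hG
  have hs0 : s ≠ 0 := by
    rintro rfl
    have := hG.2.1; simp at hs; linarith
  have hsp : 0 < |s| := abs_pos.2 hs0
  have hN : ∀ c : ℝ, |c| < 1 → (G 0 0 + (c * s) * G 0 1) ^ 2 + (G 1 0 + (c * s) * G 1 1) ^ 2 < 1 := by
    intro c hc
    refine (hst (c * s) ?_).1
    rw [abs_mul]; nlinarith
  have dn : ∀ᶠ h in nhds (0:ℝ), 8 - 9 * h ≠ 0 ∧ 8 + 9 * h ≠ 0 := by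
    filter_upwards [Ioo_mem_nhds (show (-1/10:ℝ) < 0 by norm_num) (show (0:ℝ) < 1/10 by norm_num)] with h hh
    constructor <;> linarith [hh.1, hh.2]
  have ev1 := ev_type hG s (fun _ => 0) (fun _ => 3 / 2) (fun _ => 3 / 2) (fun h => -(9 * h / 4))
    (by fun_prop) (by fun_prop) (by fun_prop) (by fun_prop (disch := norm_num))
    (by have := hN (-1/2) (by norm_num [abs_lt]); refine lt_of_eq_of_lt ?_ this; ring)
    (by filter_upwards with h; ring)
  have ev2 := ev_type hG s (fun _ => 0) (fun _ => -3) (fun _ => 0) (fun h => 0)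
    (by fun_prop) (by fun_prop) (by fun_prop) (by fun_prop)
    (by have := hN 0 (by norm_num); refine lt_of_eq_of_lt ?_ this; ring)
    (by filter_upwards with h; ring)
  have ev3 := ev_type hG s (fun h => -(9 / (8 - 9 * h))) (fun h => 3 / (8 - 9 * h))
    (fun h => 3 / (8 - 9 * h)) (fun h => -(9 * (1 - h) / (8 - 9 * h)))
    (by fun_prop (disch := norm_num)) (by fun_prop (disch := norm_num)) (by fun_prop (disch := norm_num))
    (by fun_prop (disch := norm_num))
    (by have := hN (-1/8) (by norm_num [abs_lt]); refine lt_of_eq_of_lt ?_ this; norm_num; ring)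
    (by filter_upwards [dn] with h hh
        have := inv_mul_cancel₀ hh.1
        simp only [div_eq_mul_inv]
        linear_combination (-9 * h ^ 2 * (8 - 9 * h)⁻¹) * this)
  have ev4 := ev_type hG s (fun h => 9 / (8 + 9 * h)) (fun h => 3 / (8 + 9 * h))
    (fun h => 3 / (8 + 9 * h)) (fun h => 9 * (1 + h) / (8 + 9 * h))
    (by fun_prop (disch := norm_num)) (by fun_prop (disch := norm_num)) (by fun_prop (disch := norm_num))
    (by fun_prop (disch := norm_num))
    (by have := hN (-1/8) (by norm_num [abs_lt]); refine lt_of_eq_of_lt ?_ this; norm_num; ring)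
    (by filter_upwards [dn] with h hh
        have := inv_mul_cancel₀ hh.2
        simp only [div_eq_mul_inv]
        linear_combination (-9 * h ^ 2 * (8 + 9 * h)⁻¹) * this)
  have ev5 : ∀ᶠ k in nhdsWithin (0:ℝ) (Ioi 0), -1/10 < -(k * s / 3) ∧ -(k * s / 3) < 1/10 := by
    apply nhdsWithin_le_nhds
    have hc : Continuous (fun k : ℝ => -(k * s / 3)) := by fun_prop
    have := hc.continuousAt (x := 0) (Ioo_mem_nhds (a := -1/10) (b := 1/10) (by norm_num) (by norm_num))
    exact this
  have hlim : Filter.Tendsto (fun n : ℕ => 1 / ((n : ℝ) + 1)) Filter.atTop (nhdsWithin (0:ℝ) (Ioi 0)) := by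
    rw [tendsto_nhdsWithin_iff]
    refine ⟨tendsto_one_div_add_atTop_nhds_zero_nat, ?_⟩
    filter_upwards with n
    exact mem_Ioi.2 Nat.one_div_pos_of_nat
  obtain ⟨n, v1, v2, v3, v4, v5⟩ :=
    (hlim.eventually (ev1.and (ev2.and (ev3.and (ev4.and ev5))))).exists
  have hk : 0 < 1 / ((n : ℝ) + 1) := Nat.one_div_pos_of_nat
  have hk1 : 1 / ((n : ℝ) + 1) ≤ 1 := by
    rw [div_le_one (by positivity)]; linarith [(Nat.cast_nonneg n : (0:ℝ) ≤ n)]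
  set k := 1 / ((n : ℝ) + 1) with hkdef
  clear_value k
  have h1 := v5.1.le
  have h2 := v5.2.le
  have hsol : Sol (G * Dw k (-(k * s / 3)) 0 0 (-3) 0) := by
    constructor
    · rw [Matrix.det_mul, hG.1, Dw, Matrix.det_fin_two_of]; ring
    · rw [← hs]
      simp only [Dw, Matrix.mul_apply, Fin.sum_univ_two, Matrix.of_apply, Matrix.cons_val_zero, Matrix.cons_val_one, Matrix.cons_val', Matrix.cons_val_fin_one]
      have : -(k * s / 3) * -3 / k = s := by field_simp
      rw [this]; ring
  have hid : KK m (G * Dw k (-(k * s / 3)) 0 0 0 0) := by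
    have : Dw k (-(k * s / 3)) 0 0 0 0 = 1 := by
      ext i j; fin_cases i <;> fin_cases j <;> simp [Dw]
    rw [this, mul_one]; exact hG
  refine ⟨n, blk G k (-(k * s / 3)), blk_lip hG hk hk1 h1 h2 hs, ?_, ?_, ?_⟩
  · intro z hz
    rw [← hkdef] at hz
    have hz' : 1 ≤ |z 0 / k| ∨ 1 ≤ |z 1| := by
      rcases hz with hz | hz
      · left; rw [abs_div, abs_of_pos hk, le_div_iff₀ hk]; linarith
      · right; exact hz
    rw [blk, phiq_out h1 h2 hz', phip_out h1 h2 hz']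
    congr 1
    ext i; fin_cases i <;> simp
  · filter_upwards [ae_gen (h := -(k * s / 3)) (σ := 1) hk one_ne_zero,
      ae_gen (h := -(k * s / 3)) (σ := -1) hk (by norm_num)] with z g1 g2
    obtain ⟨q1, q2, p1, p2, H, HT⟩ := hat_gen h1 h2 (by simpa using g1) (by simpa using g2)
    rcases HT with HT | ⟨rfl, rfl, rfl, rfl⟩
    · left
      apply blk_locaff hk H
      rcases HT with ⟨rfl, rfl, rfl, rfl⟩ | ⟨rfl, rfl, rfl, rfl⟩ | ⟨rfl, rfl, rfl, rfl⟩ | ⟨rfl, rfl, rfl, rfl⟩ | ⟨rfl, rfl, rfl, rfl⟩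
      · exact hid
      · exact v1
      · exact v2
      · exact v3
      · exact v4
    · right
      exact blk_locaff hk H hsol
  · intro z z1 z2 z3
    rw [← hkdef] at z1 z2
    rw [abs_lt] at z3
    have w1 : 5 / 6 < z 0 / k := by rwa [lt_div_iff₀ hk]
    have w2 : z 0 / k < 1 := by rwa [div_lt_one hk]
    exact blk_locaff hk (hat1 h1 h2 w2 (by linarith) (by linarith)) hsol



/-- closed rectangle -/
def Rc (c : E2) (r κ : ℝ) : Set E2 := {z | |z 0 - c 0| ≤ r * κ ∧ |z 1 - c 1| ≤ r}
/-- open rectangle -/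
def Ro (c : E2) (r κ : ℝ) : Set E2 := {z | |z 0 - c 0| < r * κ ∧ |z 1 - c 1| < r}
/-- open subrectangle in which the inclusion is solved -/
def Rs (c : E2) (r κ : ℝ) : Set E2 :=
  {z | (5 / 6 * (r * κ) < z 0 - c 0 ∧ z 0 - c 0 < r * κ) ∧ |z 1 - c 1| < 1 / 2 * r}

lemma Rc_closed (c : E2) (r κ : ℝ) : IsClosed (Rc c r κ) := by
  rw [Rc, Set.ofPred_and]
  exact (isClosed_le (by fun_prop) (by fun_prop)).inter (isClosed_le (by fun_prop) (by fun_prop))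

lemma Ro_open (c : E2) (r κ : ℝ) : IsOpen (Ro c r κ) := by
  rw [Ro, Set.ofPred_and]
  exact (isOpen_lt (by fun_prop) (by fun_prop)).inter (isOpen_lt (by fun_prop) (by fun_prop))

lemma Rs_open (c : E2) (r κ : ℝ) : IsOpen (Rs c r κ) := by
  rw [Rs, Set.ofPred_and, Set.ofPred_and]
  exact ((isOpen_lt (by fun_prop) (by fun_prop)).inter (isOpen_lt (by fun_prop) (by fun_prop))).inter
    (isOpen_lt (by fun_prop) (by fun_prop))

lemma Ro_sub (c : E2) (r κ : ℝ) : Ro c r κ ⊆ Rc c r κ := fun _ hz => ⟨hz.1.le, hz.2.le⟩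

lemma Rs_sub (c : E2) {r κ : ℝ} (hr : 0 < r) (hκ : 0 < κ) : Rs c r κ ⊆ Ro c r κ := by
  intro z hz
  have : 0 < r * κ := by positivity
  refine ⟨abs_lt.2 ⟨by linarith [hz.1.1], hz.1.2⟩, hz.2.trans (by linarith)⟩

lemma Rc_vol (c : E2) {r κ : ℝ} (hr : 0 < r) (hκ : 0 < κ) :
    volume (Rc c r κ) = ENNReal.ofReal (4 * (r * κ * r)) := by
  have : Rc c r κ = Icc ![c 0 - r * κ, c 1 - r] ![c 0 + r * κ, c 1 + r] := by
    ext z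
    simp only [Rc, Set.mem_ofPred_eq, mem_Icc, Pi.le_def, Fin.forall_fin_two, abs_le]
    simp
    constructor
    · rintro ⟨⟨a, b⟩, c, d⟩; refine ⟨⟨?_, ?_⟩, ?_, ?_⟩ <;> linarith
    · rintro ⟨⟨a, b⟩, c, d⟩; refine ⟨⟨?_, ?_⟩, ?_, ?_⟩ <;> linarith
  rw [this, Real.volume_Icc_pi, Fin.prod_univ_two, ← ENNReal.ofReal_mul (by simp; nlinarith [mul_pos hr hκ])]
  congr 1; simp; ring

lemma Rs_vol (c : E2) {r κ : ℝ} (hr : 0 < r) (hκ : 0 < κ) :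
    24 * volume (Rs c r κ) = volume (Rc c r κ) := by
  have : Rs c r κ = Set.pi univ (fun i => Ioo ((![c 0 + 5 / 6 * (r * κ), c 1 - 1 / 2 * r] : E2) i)
      ((![c 0 + r * κ, c 1 + 1 / 2 * r] : E2) i)) := by
    ext z
    simp only [Rs, Set.mem_ofPred_eq, mem_univ_pi, mem_Ioo, Fin.forall_fin_two, abs_lt]
    simp
    constructor
    · rintro ⟨⟨a, b⟩, c, d⟩; refine ⟨⟨?_, ?_⟩, ?_, ?_⟩ <;> linarith
    · rintro ⟨⟨a, b⟩, c, d⟩; refine ⟨⟨?_, ?_⟩, ?_, ?_⟩ <;> linarith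
  rw [Rc_vol c hr hκ, this, Real.volume_pi_Ioo, Fin.prod_univ_two,
    ← ENNReal.ofReal_mul (by simp; nlinarith [mul_pos hr hκ]),
    show (24 : ENNReal) = ENNReal.ofReal 24 by simp, ← ENNReal.ofReal_mul (by norm_num)]
  congr 1; simp; ring

lemma cover (U : Set E2) (hU : IsOpen U) (N : E2 → ℕ)
    (hN : ∀ x ∈ U, ∀ᶠ y in nhds x, N y = N x) (T : Set (E2 × ℝ))
    (hT : ∀ x ∈ U, ∃ ε > 0, ∀ r, 0 < r → r < ε → (x, r) ∈ T) :
    ∃ J ⊆ T, J.Countable ∧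
      (∀ a ∈ J, a.1 ∈ U ∧ 0 < a.2 ∧ Rc a.1 a.2 (1 / ((N a.1 : ℝ) + 1)) ⊆ U) ∧
      J.PairwiseDisjoint (fun a => Rc a.1 a.2 (1 / ((N a.1 : ℝ) + 1))) ∧
      volume (U \ ⋃ a ∈ J, Rc a.1 a.2 (1 / ((N a.1 : ℝ) + 1))) = 0 := by
  set B : E2 × ℝ → Set E2 := fun a => Rc a.1 a.2 (1 / ((N a.1 : ℝ) + 1)) with hB
  have hkp : ∀ n : ℕ, 0 < 1 / ((n : ℝ) + 1) := fun n => Nat.one_div_pos_of_nat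
  have hk1 : ∀ n : ℕ, 1 / ((n : ℝ) + 1) ≤ 1 := fun n => by
    rw [div_le_one (by positivity)]; linarith [(Nat.cast_nonneg n : (0:ℝ) ≤ n)]
  let S : ℕ → Set E2 := fun n => {x ∈ U | N x = n}
  let t : ℕ → Set (E2 × ℝ) := fun n => {a ∈ T | a.1 ∈ S n ∧ 0 < a.2 ∧ B a ⊆ S n}
  have hball : ∀ a : E2 × ℝ, 0 < a.2 → B a ⊆ Metric.closedBall a.1 a.2 := by
    intro a ha z hz
    rw [Metric.mem_closedBall, dist_pi_le_iff ha.le]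
    intro i
    rw [Real.dist_eq]
    fin_cases i
    · exact hz.1.trans (by have := hk1 (N a.1); have := mul_le_mul_of_nonneg_left this ha.le; linarith)
    · exact hz.2
  have hV : ∀ n, ∃ J ⊆ t n, J.Countable ∧ J.PairwiseDisjoint B ∧ volume (S n \ ⋃ a ∈ J, B a) = 0 := by
    intro n
    refine Vitali.exists_disjoint_covering_ae volume (S n) (t n) (9 * ((n : NNReal) + 1)) (fun a => a.2)
      (fun a => a.1) B (fun a ha => hball a ha.2.2.1) ?_ ?_ (fun a _ => Rc_closed _ _ _) ?_
    · rintro a ⟨-, h2, h3, -⟩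
      have hn : N a.1 = n := h2.2
      rw [hB]; simp only
      rw [Rc_vol a.1 h3 (hkp _), Real.volume_pi_closedBall _ (by positivity), hn]
      rw [← ENNReal.ofReal_coe_nnreal, ← ENNReal.ofReal_mul (by positivity)]
      apply ENNReal.ofReal_le_ofReal
      simp
      apply le_of_eq
      field_simp
      ring
    · rintro a ⟨-, -, h3, -⟩
      refine ⟨a.1, ?_⟩
      rw [mem_interior]
      refine ⟨Ro a.1 a.2 (1 / ((N a.1 : ℝ) + 1)), Ro_sub _ _ _, Ro_open _ _ _, ?_⟩
      have := mul_pos h3 (hkp (N a.1))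
      refine ⟨?_, ?_⟩ <;> rw [sub_self, abs_zero] <;> assumption
    · intro x hx ε hε
      have hmem : S n ∈ nhds x := by
        filter_upwards [hU.mem_nhds hx.1, hN x hx.1] with y hy hy'
        exact ⟨hy, hy'.trans hx.2⟩
      obtain ⟨δ, hδ, hδs⟩ := Metric.nhds_basis_closedBall.mem_iff.1 hmem
      obtain ⟨ε', hε', hT'⟩ := hT x hx.1
      set r := min (min ε δ) (ε' / 2) with hr
      have hr0 : 0 < r := by positivity
      have hr1 : r ≤ ε := (min_le_left _ _).trans (min_le_left _ _)
      have hr2 : r ≤ δ := (min_le_left _ _).trans (min_le_right _ _)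
      have hr3 : r < ε' := (min_le_right _ _).trans_lt (by linarith)
      refine ⟨(x, r), ⟨hT' r hr0 hr3, hx, hr0, ?_⟩, hr1, rfl⟩
      exact (hball (x, r) hr0).trans ((Metric.closedBall_subset_closedBall hr2).trans hδs)
  choose J hJt hJc hJd hJv using hV
  refine ⟨⋃ n, J n, iUnion_subset fun n a ha => (hJt n ha).1, countable_iUnion hJc, ?_, ?_, ?_⟩
  · intro a ha
    obtain ⟨n, hn⟩ := mem_iUnion.1 ha
    obtain ⟨-, h2, h3, h4⟩ := hJt n hn
    exact ⟨h2.1, h3, fun z hz => (h4 hz).1⟩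
  · intro a ha b hb hab
    obtain ⟨n, hn⟩ := mem_iUnion.1 ha
    obtain ⟨n', hn'⟩ := mem_iUnion.1 hb
    by_cases h : n = n'
    · subst h; exact hJd n hn hn' hab
    · refine Set.disjoint_left.2 fun z hz hz' => h ?_
      exact ((hJt n hn).2.2.2 hz).2.symm.trans ((hJt n' hn').2.2.2 hz').2
  · refine measure_mono_null (t := ⋃ n, (S n \ ⋃ a ∈ J n, B a)) ?_ (measure_iUnion_null hJv)
    rintro x ⟨hx, hx'⟩
    refine mem_iUnion.2 ⟨N x, ⟨hx, rfl⟩, fun h => hx' ?_⟩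
    simp only [mem_iUnion] at h ⊢
    obtain ⟨a, ha, hz⟩ := h
    exact ⟨a, ⟨_, ha⟩, hz⟩

lemma ae_scale {P : E2 → Prop} (h : ∀ᵐ w : E2, P w) (c : E2) {r : ℝ} (hr : 0 < r) :
    ∀ᵐ z : E2, P (r⁻¹ • (z - c)) := by
  rw [ae_iff] at h ⊢
  have : {a : E2 | ¬ P (r⁻¹ • (a - c))} = (fun z => z - c) ⁻¹' ((fun z => r⁻¹ • z) ⁻¹' {a | ¬ P a}) := rfl
  rw [this]
  simp only [sub_eq_add_neg]
  rw [measure_preimage_add_right, Measure.addHaar_preimage_smul _ (inv_ne_zero hr.ne'), h, mul_zero]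

lemma scale_lip {L : NNReal} {g : E2 → E2} (hg : LipschitzWith L g) (c d : E2) {r : ℝ} (hr : 0 < r) :
    LipschitzWith L (fun z => r • g (r⁻¹ • (z - c)) + d) := by
  apply LipschitzWith.of_dist_le_mul
  intro x y
  rw [dist_add_right, dist_smul₀, Real.norm_of_nonneg hr.le]
  have := hg.dist_le_mul (r⁻¹ • (x - c)) (r⁻¹ • (y - c))
  rw [dist_smul₀, Real.norm_of_nonneg (inv_nonneg.2 hr.le), dist_sub_right] at this
  calc _ ≤ r * (L * (r⁻¹ * dist x y)) := by gcongr
    _ = _ := by field_simp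



lemma step {m : NNReal} {u : E2 → E2} (hu : LipschitzWith (m + 6) u) {U : Set E2} (hU : IsOpen U)
    (hUf : volume U ≠ ⊤) (hK : ∀ x ∈ U, LocAff u (KK m) x) :
    ∃ (u' : E2 → E2) (U' : Set E2), LipschitzWith (m + 6) u' ∧ U' ⊆ U ∧ IsOpen U' ∧
      (∀ x ∈ U', LocAff u' (KK m) x) ∧ (∀ x, x ∉ U → u' x = u x) ∧
      (∀ᵐ x : E2, x ∈ U → x ∈ U' ∨ LocAff u' Sol x) ∧
      (volume U').toReal ≤ 23 / 24 * (volume U).toReal := by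
  classical
  have hblock : ∀ G : M2, ∃ n : ℕ, ∃ g : E2 → E2, KK m G →
    (LipschitzWith (m + 6) g ∧
    (∀ z : E2, (1 / ((n : ℝ) + 1) ≤ |z 0| ∨ 1 ≤ |z 1|) → g z = G *ᵥ z) ∧
    (∀ᵐ z : E2, LocAff g (KK m) z ∨ LocAff g Sol z) ∧
    ∀ z : E2, 5 / 6 * (1 / ((n : ℝ) + 1)) < z 0 → z 0 < 1 / ((n : ℝ) + 1) → |z 1| < 1 / 2 →
      LocAff g Sol z) := by
    intro G
    by_cases hG : KK m G
    · obtain ⟨n, g, h⟩ := block hG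
      exact ⟨n, g, fun _ => h⟩
    · exact ⟨0, id, fun h => absurd h hG⟩
  choose N gg hb using hblock
  set Gr : E2 → M2 := gradMatrix u with hGr
  set κ : E2 → ℝ := fun c => 1 / ((N (Gr c) : ℝ) + 1) with hκ
  have hκ0 : ∀ c, 0 < κ c := fun c => Nat.one_div_pos_of_nat
  have hκ1 : ∀ c, κ c ≤ 1 := fun c => by
    simp only [hκ]
    rw [div_le_one (by positivity)]; linarith [(Nat.cast_nonneg (N (Gr c)) : (0:ℝ) ≤ _)]
  obtain ⟨J, hJT, hJc, hJU, hJd, hJv⟩ := cover U hU (fun x => N (Gr x))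
    (fun x hx => by
      filter_upwards [(hK x hx).grad_loc] with y hy
      simp only [hGr, hy])
    {a | ∀ z ∈ Rc a.1 a.2 (κ a.1), u z = Gr a.1 *ᵥ (z - a.1) + u a.1}
    (by
      intro x hx
      obtain ⟨G, hG, b, hgb⟩ := hK x hx
      obtain ⟨ε, hε, hball⟩ := Metric.nhds_basis_ball.mem_iff.1 hgb
      refine ⟨ε, hε, fun r hr hrε z hz => ?_⟩
      have hGx : Gr x = G := (grad_aff hgb).2
      have hzb : z ∈ Metric.ball x ε := by
        rw [Metric.mem_ball]
        refine lt_of_le_of_lt ?_ hrε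
        rw [dist_pi_le_iff hr.le]
        intro i
        rw [Real.dist_eq]
        fin_cases i
        · refine hz.1.trans ?_
          have := mul_le_mul_of_nonneg_left (hκ1 x) hr.le
          simp only at this ⊢
          linarith
        · exact hz.2
      have e1 : u z = G *ᵥ z + b := hball hzb
      have e2 : u x = G *ᵥ x + b := hgb.self_of_nhds
      simp only [hGx]
      rw [e1, e2, Matrix.mulVec_sub]; abel)
  have hKG : ∀ a ∈ J, KK m (Gr a.1) := fun a ha => (hK a.1 (hJU a ha).1).diff.2
  let R : J → Set E2 := fun a => Ro a.1.1 a.1.2 (κ a.1.1)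
  let f : J → E2 → E2 := fun a z => a.1.2 • gg (Gr a.1.1) (a.1.2⁻¹ • (z - a.1.1)) + u a.1.1
  have hRd : ∀ i j : J, i ≠ j → Disjoint (R i) (R j) := by
    intro i j hij
    exact (hJd i.2 j.2 (fun h => hij (Subtype.ext h))).mono (Ro_sub _ _ _) (Ro_sub _ _ _)
  let u' : E2 → E2 := fun z => if h : ∃ j : J, z ∈ R j then f h.choose z else u z
  have hu1 : ∀ j : J, ∀ z ∈ R j, u' z = f j z := by
    intro j z hz
    have h : ∃ j : J, z ∈ R j := ⟨j, hz⟩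
    have : h.choose = j := by
      by_contra hne
      exact Set.disjoint_left.1 (hRd _ _ hne) h.choose_spec hz
    simp only [u', dif_pos h, this]
  have hu2 : ∀ z, (∀ j : J, z ∉ R j) → u' z = u z := by
    intro z hz
    have : ¬ ∃ j : J, z ∈ R j := fun ⟨j, hj⟩ => hz j hj
    simp only [u', dif_neg this]
  have hLip : LipschitzWith (m + 6) u' := by
    refine glue_lipschitz R (fun j => Ro_open _ _ _) hRd (m + 6) u hu f
      (fun j => scale_lip (hb _ (hKG j.1 j.2)).1 _ _ (hJU j.1 j.2).2.1) ?_ u' hu1 hu2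
    intro j z hz
    have hr := (hJU j.1 j.2).2.1
    have hz1 : z ∈ Rc j.1.1 j.1.2 (κ j.1.1) :=
      closure_minimal (Ro_sub _ _ _) (Rc_closed _ _ _) (frontier_subset_closure hz)
    have hz2 : z ∉ R j := by
      have := hz.2; rwa [(Ro_open _ _ _).interior_eq] at this
    have e := hJT j.2 z hz1
    rw [e]
    have key : gg (Gr j.1.1) (j.1.2⁻¹ • (z - j.1.1)) = Gr j.1.1 *ᵥ (j.1.2⁻¹ • (z - j.1.1)) := by
      apply (hb _ (hKG j.1 j.2)).2.1
      by_contra hcon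
      push Not at hcon
      apply hz2
      simp only [Pi.smul_apply, Pi.sub_apply, smul_eq_mul, abs_mul, abs_inv, abs_of_pos hr] at hcon
      refine ⟨?_, ?_⟩
      · have := hcon.1
        rw [inv_mul_lt_iff₀ hr] at this
        exact this
      · have := hcon.2
        rw [inv_mul_lt_iff₀ hr, mul_one] at this
        exact this
    simp only [f, key, Matrix.mulVec_smul, smul_smul, mul_inv_cancel₀ hr.ne', one_smul]
  have hloc : ∀ (j : J) (P : M2 → Prop) (z : E2), z ∈ R j →
      LocAff (gg (Gr j.1.1)) P (j.1.2⁻¹ • (z - j.1.1)) → LocAff u' P z := by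
    intro j P z hz h
    refine (h.scale (hJU j.1 j.2).2.1 (d := u j.1.1)).congr ?_
    filter_upwards [(Ro_open _ _ _).mem_nhds hz] with y hy
    exact hu1 j y hy
  have hRs : ∀ a (ha : a ∈ J), ∀ z ∈ Rs a.1 a.2 (κ a.1), LocAff u' Sol z := by
    intro a ha z hz
    have hr := (hJU a ha).2.1
    refine hloc ⟨a, ha⟩ Sol z (Rs_sub _ hr (hκ0 _) hz) ?_
    apply (hb _ (hKG a ha)).2.2.2
    · simp only [Pi.smul_apply, Pi.sub_apply, smul_eq_mul]
      rw [← div_eq_inv_mul, lt_div_iff₀ hr]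
      have := hz.1.1
      simp only [hκ] at this
      linarith
    · simp only [Pi.smul_apply, Pi.sub_apply, smul_eq_mul]
      rw [← div_eq_inv_mul, div_lt_iff₀ hr]
      have := hz.1.2
      simp only [hκ] at this
      linarith
    · simp only [Pi.smul_apply, Pi.sub_apply, smul_eq_mul, abs_mul, abs_inv, abs_of_pos hr]
      rw [← div_eq_inv_mul, div_lt_iff₀ hr]
      exact hz.2
  refine ⟨u', U ∩ {x | LocAff u' (KK m) x}, hLip, inter_subset_left, hU.inter (LocAff.isOpen _ _),
    fun x hx => hx.2, ?_, ?_, ?_⟩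
  · intro x hx
    apply hu2
    intro j hj
    exact hx ((hJU j.1 j.2).2.2 (Ro_sub _ _ _ hj))
  · have h1 : ∀ᵐ x : E2, x ∉ U \ ⋃ a ∈ J, Rc a.1 a.2 (κ a.1) :=
      measure_eq_zero_iff_ae_notMem.1 hJv
    have h2 : ∀ᵐ x : E2, ∀ a ∈ J, (LocAff (gg (Gr a.1)) (KK m) (a.2⁻¹ • (x - a.1)) ∨
        LocAff (gg (Gr a.1)) Sol (a.2⁻¹ • (x - a.1))) ∧ x ∉ Rc a.1 a.2 (κ a.1) \ Ro a.1 a.2 (κ a.1) := by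
      rw [ae_ball_iff hJc]
      intro a ha
      filter_upwards [ae_scale (hb _ (hKG a ha)).2.2.1 a.1 (hJU a ha).2.1,
        null_line (a := 1) (b := 0) (c := a.1 0 + a.2 * κ a.1) (by norm_num),
        null_line (a := 1) (b := 0) (c := a.1 0 - a.2 * κ a.1) (by norm_num),
        null_line (a := 0) (b := 1) (c := a.1 1 + a.2) (by norm_num),
        null_line (a := 0) (b := 1) (c := a.1 1 - a.2) (by norm_num)] with x hx n1 n2 n3 n4
      refine ⟨hx, ?_⟩
      rintro ⟨⟨c1, c2⟩, hx2⟩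
      apply hx2
      refine ⟨lt_of_le_of_ne c1 ?_, lt_of_le_of_ne c2 ?_⟩
      · intro e
        rcases eq_or_eq_neg_of_abs_eq e with e | e
        · apply n1; linarith
        · apply n2; linarith
      · intro e
        rcases eq_or_eq_neg_of_abs_eq e with e | e
        · apply n3; linarith
        · apply n4; linarith
    filter_upwards [h1, h2] with x hx1 hx2 hxU
    have : x ∈ ⋃ a ∈ J, Rc a.1 a.2 (κ a.1) := by
      by_contra hcon; exact hx1 ⟨hxU, hcon⟩
    simp only [mem_iUnion] at this
    obtain ⟨a, ha, hxa⟩ := this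
    obtain ⟨hP, hR⟩ := hx2 a ha
    have hxo : x ∈ Ro a.1 a.2 (κ a.1) := by
      by_contra hcon; exact hR ⟨hxa, hcon⟩
    rcases hP with hP | hP
    · exact Or.inl ⟨hxU, hloc ⟨a, ha⟩ _ x hxo hP⟩
    · exact Or.inr (hloc ⟨a, ha⟩ _ x hxo hP)
  · set W : Set E2 := ⋃ a ∈ J, Rs a.1 a.2 (κ a.1) with hW
    set U' := U ∩ {x | LocAff u' (KK m) x} with hU'
    have hsub : ∀ a ∈ J, Rs a.1 a.2 (κ a.1) ⊆ Rc a.1 a.2 (κ a.1) := fun a ha =>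
      (Rs_sub _ (hJU a ha).2.1 (hκ0 _)).trans (Ro_sub _ _ _)
    have hdis : Disjoint U' W := by
      refine Set.disjoint_left.2 ?_
      intro x hx hxW
      simp only [hW, mem_iUnion] at hxW
      obtain ⟨a, ha, hxa⟩ := hxW
      exact LocAff.disj hx.2 (hRs a ha x hxa)
    have hWo : MeasurableSet W := MeasurableSet.biUnion hJc fun a _ => (Rs_open _ _ _).measurableSet
    have hWU : U' ∪ W ⊆ U := by
      refine union_subset inter_subset_left ?_
      refine iUnion₂_subset fun a ha => (hsub a ha).trans (hJU a ha).2.2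
    have hsum : volume U' + volume W ≤ volume U := by
      rw [← measure_union hdis hWo]; exact measure_mono hWU
    have hWv : volume U ≤ 24 * volume W := by
      have e1 : volume W = ∑' a : J, volume (Rs a.1.1 a.1.2 (κ a.1.1)) :=
        measure_biUnion hJc (hJd.mono_on fun a ha => hsub a ha) fun a _ => (Rs_open _ _ _).measurableSet
      have e2 : volume (⋃ a ∈ J, Rc a.1 a.2 (κ a.1)) = ∑' a : J, volume (Rc a.1.1 a.1.2 (κ a.1.1)) :=
        measure_biUnion hJc hJd fun a _ => (Rc_closed _ _ _).measurableSet
      have e3 : volume (⋃ a ∈ J, Rc a.1 a.2 (κ a.1)) = 24 * volume W := by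
        rw [e1, e2, ← ENNReal.tsum_mul_left]
        congr 1; ext a
        rw [Rs_vol _ (hJU a.1 a.2).2.1 (hκ0 _)]
      rw [← e3]
      calc volume U ≤ volume ((U \ ⋃ a ∈ J, Rc a.1 a.2 (κ a.1)) ∪ ⋃ a ∈ J, Rc a.1 a.2 (κ a.1)) := by
            apply measure_mono; rw [sdiff_union_self]; exact subset_union_left
        _ ≤ volume (U \ ⋃ a ∈ J, Rc a.1 a.2 (κ a.1)) + volume (⋃ a ∈ J, Rc a.1 a.2 (κ a.1)) :=
            measure_union_le _ _
        _ = _ := by rw [hJv, zero_add]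
    have hWf : volume W ≠ ⊤ := ne_top_of_le_ne_top hUf (measure_mono (subset_union_right.trans hWU))
    have hU'f : volume U' ≠ ⊤ := ne_top_of_le_ne_top hUf (measure_mono inter_subset_left)
    have r1 := ENNReal.toReal_mono hUf hsum
    rw [ENNReal.toReal_add hU'f hWf] at r1
    have r2 := ENNReal.toReal_mono (ENNReal.mul_ne_top (by norm_num) hWf) hWv
    rw [ENNReal.toReal_mul] at r2
    simp at r2
    linarith



/-- states of the iteration -/
structure IState (m : NNReal) where
  u : E2 → E2
  U : Set E2
  lip : LipschitzWith (m + 6) u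
  op : IsOpen U
  fin : volume U ≠ ⊤
  aff : ∀ x ∈ U, LocAff u (KK m) x

lemma aff_lip {m : NNReal} {G : M2} (hG : KK m G) (b : E2) :
    LipschitzWith (m + 6) (fun x : E2 => G *ᵥ x + b) := by
  apply LipschitzWith.of_dist_le_mul
  intro z w
  rw [dist_pi_le_iff (by positivity)]
  intro i
  obtain ⟨c0, c1⟩ := hG.entry i
  rw [Real.dist_eq]
  have e : (G *ᵥ z + b) i - (G *ᵥ w + b) i = G i 0 * (z 0 - w 0) + G i 1 * (z 1 - w 1) := by
    simp only [Matrix.mulVec, dotProduct, Fin.sum_univ_two, Pi.add_apply]; ring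
  rw [e]
  refine lin_le (dist_le_pi_dist z w 0) (dist_le_pi_dist z w 1) ?_
  push_cast; linarith

lemma main_strict {m : NNReal} {G : M2} (hG : KK m G) (b : E2) {O : Set E2} (hO : IsOpen O)
    (hOf : volume O ≠ ⊤) :
    ∃ w : E2 → E2, LipschitzWith (m + 6) w ∧ (∀ x, x ∉ O → w x = G *ᵥ x + b) ∧
      ∀ᵐ x : E2, x ∈ O → LocAff w Sol x := by
  have hstep : ∀ s : IState m, ∃ s' : IState m, s'.U ⊆ s.U ∧ (∀ x, x ∉ s.U → s'.u x = s.u x) ∧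
      (∀ᵐ x : E2, x ∈ s.U → x ∈ s'.U ∨ LocAff s'.u Sol x) ∧
      (volume s'.U).toReal ≤ 23 / 24 * (volume s.U).toReal := by
    intro s
    obtain ⟨u', U', a1, a2, a3, a4, a5, a6, a7⟩ := step s.lip s.op s.fin s.aff
    exact ⟨⟨u', U', a1, a3, ne_top_of_le_ne_top s.fin (measure_mono a2), a4⟩, a2, a5, a6, a7⟩
  choose nxt n1 n2 n3 n4 using hstep
  let s0 : IState m := ⟨fun x => G *ᵥ x + b, O, aff_lip hG b, hO, hOf,
    fun x _ => ⟨G, hG, b, Filter.Eventually.of_forall fun _ => rfl⟩⟩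
  let S : ℕ → IState m := fun n => Nat.rec s0 (fun _ s => nxt s) n
  have hS : ∀ n, S (n + 1) = nxt (S n) := fun n => rfl
  have hanti : Antitone (fun n => (S n).U) := antitone_nat_of_succ_le fun n => by
    rw [hS]; exact n1 (S n)
  have hconst : ∀ n k x, x ∉ (S n).U → n ≤ k → (S k).u x = (S n).u x := by
    intro n k x hx hk
    induction k, hk using Nat.le_induction with
    | base => rfl
    | succ k hk ih =>
      rw [hS, n2 (S k) x (fun h => hx (hanti hk h)), ih]
  have hvol : ∀ n, (volume (S n).U).toReal ≤ (23 / 24) ^ n * (volume O).toReal := by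
    intro n
    induction n with
    | zero => simp [S, s0]
    | succ n ih =>
      rw [hS]
      refine (n4 (S n)).trans ?_
      rw [pow_succ]; linarith
  set Z : Set E2 := ⋂ n, (S n).U with hZ
  have hZ0 : volume Z = 0 := by
    have hZf : volume Z ≠ ⊤ := ne_top_of_le_ne_top hOf (measure_mono (iInter_subset _ 0))
    have hle : ∀ n, (volume Z).toReal ≤ (23 / 24) ^ n * (volume O).toReal := fun n =>
      (ENNReal.toReal_mono (S n).fin (measure_mono (iInter_subset _ n))).trans (hvol n)
    have hlim : Filter.Tendsto (fun n : ℕ => (23 / 24 : ℝ) ^ n * (volume O).toReal) Filter.atTop (nhds 0) := by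
      have := (tendsto_pow_atTop_nhds_zero_of_lt_one (r := (23 / 24 : ℝ)) (by norm_num)
        (by norm_num)).mul_const (volume O).toReal
      simpa using this
    have h0 : (volume Z).toReal ≤ 0 := ge_of_tendsto' hlim hle
    have h1 : (volume Z).toReal = 0 := le_antisymm h0 ENNReal.toReal_nonneg
    exact (ENNReal.toReal_eq_zero_iff _).1 h1 |>.resolve_right hZf
  have hex : ∀ x ∈ Zᶜ, ∃ n, x ∉ (S n).U := by
    intro x hx
    simpa [hZ] using hx
  choose! ν hν using hex
  have hf : ∀ x ∈ Zᶜ, ∀ k, x ∉ (S k).U → (S (ν x)).u x = (S k).u x := by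
    intro x hx k hk
    rcases le_total (ν x) k with h | h
    · exact (hconst _ _ x (hν x hx) h).symm
    · exact hconst _ _ x hk h
  have hlip : LipschitzOnWith (m + 6) (fun x => (S (ν x)).u x) Zᶜ := by
    apply LipschitzOnWith.of_dist_le_mul
    intro x hx y hy
    set k := max (ν x) (ν y)
    have e1 : (S (ν x)).u x = (S k).u x := hf x hx k fun h => hν x hx (hanti (le_max_left _ _) h)
    have e2 : (S (ν y)).u y = (S k).u y := hf y hy k fun h => hν y hy (hanti (le_max_right _ _) h)
    simp only [e1, e2]
    exact (S k).lip.dist_le_mul x y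
  obtain ⟨w, hw, hwe⟩ := hlip.extend_pi
  have hwk : ∀ k x, x ∉ (S k).U → w x = (S k).u x := by
    intro k x hx
    have hxZ : x ∈ Zᶜ := fun h => hx (mem_iInter.1 h k)
    rw [← hwe hxZ]
    exact hf x hxZ k hx
  refine ⟨w, hw, fun x hx => hwk 0 x hx, ?_⟩
  have hae : ∀ᵐ x : E2, ∀ n, x ∈ (S n).U → x ∈ (S (n + 1)).U ∨ LocAff (S (n + 1)).u Sol x :=
    ae_all_iff.2 fun n => n3 (S n)
  filter_upwards [measure_eq_zero_iff_ae_notMem.1 hZ0, hae] with x hxZ hx hxO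
  obtain ⟨n, h1, h2⟩ : ∃ n, x ∈ (S n).U ∧ x ∉ (S (n + 1)).U := by
    by_contra hcon
    push Not at hcon
    apply hxZ
    refine mem_iInter.2 fun n => ?_
    induction n with
    | zero => exact hxO
    | succ n ih => exact hcon n ih
  have hsol := (hx n h1).resolve_left h2
  refine hsol.congr ?_
  filter_upwards [(LocAff.isOpen (S (n + 1)).u Sol).mem_nhds hsol] with y hy
  exact hwk (n + 1) y fun h => LocAff.disj ((S (n + 1)).aff y h) hy



lemma aff_lip_any (A : M2) (b : E2) : ∃ L : NNReal, LipschitzWith L (fun x : E2 => A *ᵥ x + b) := by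
  refine ⟨‖LinearMap.toContinuousLinearMap (Matrix.toLin' A)‖₊, ?_⟩
  have h := (LinearMap.toContinuousLinearMap (Matrix.toLin' A)).lipschitz
  intro x y
  change edist (A *ᵥ x + b) (A *ᵥ y + b) ≤ _
  rw [edist_add_right]
  exact h x y

lemma enorm2_e1 (G : M2) : enorm2 (G *ᵥ e1) = Real.sqrt (G 0 0 ^ 2 + G 1 0 ^ 2) := by
  simp [enorm2, e1, Matrix.mulVec, dotProduct, Fin.sum_univ_two]

lemma mem_calM_of_Sol {G : M2} (h : Sol G) : G ∈ calM e1 := by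
  refine ⟨h.1, ?_⟩
  rw [enorm2_e1, h.2, Real.sqrt_one]

lemma rot_mul_transpose {Q : M2} (hQ : Q ∈ SO2) : Q * Qᵀ = 1 ∧ Qᵀ * Q = 1 := by
  have h1 : Q * Qᵀ = 1 := by
    obtain ⟨θ, rfl⟩ := hQ
    have h := Real.sin_sq_add_cos_sq θ
    ext i j
    fin_cases i <;> fin_cases j <;>
      simp [rot, Matrix.mul_apply, Fin.sum_univ_two] <;> nlinarith
  exact ⟨h1, mul_eq_one_comm.1 h1⟩

lemma ae_lin {R S : M2} (hRS : S * R = 1) {p : E2 → Prop} (hp : ∀ᵐ x : E2, p x) :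
    ∀ᵐ x : E2, p (R *ᵥ x) := by
  have hdet : LinearMap.det (Matrix.toLin' R) ≠ 0 := by
    rw [LinearMap.det_toLin']
    intro h
    have := congrArg Matrix.det hRS
    simp [h] at this
  rw [ae_iff] at hp ⊢
  have := Measure.addHaar_preimage_linearMap (volume : Measure E2) hdet {x | ¬ p x}
  rw [hp, mul_zero] at this
  rw [← this]
  congr 1

lemma piece {V : Set E2} (hV : IsOpen V) (hVf : volume V ≠ ⊤) {Q A : M2} (hQ : Q ∈ SO2)
    (hA : A * Q ∈ calN e1) (b : E2) :
    ∃ (L : NNReal) (u : E2 → E2), LipschitzWith L u ∧ (∀ x, x ∉ V → u x = A *ᵥ x + b) ∧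
      ∀ᵐ x : E2, x ∈ V → LocAff u (fun G => G * Q ∈ calM e1) x := by
  obtain ⟨hdet, hn⟩ := hA
  rw [enorm2_e1, Real.sqrt_le_iff, one_pow] at hn
  replace hn := hn.2
  obtain ⟨q1, q2⟩ := rot_mul_transpose hQ
  rcases hn.eq_or_lt with h | h
  · obtain ⟨L, hL⟩ := aff_lip_any A b
    refine ⟨L, _, hL, fun _ _ => rfl, Filter.Eventually.of_forall fun x _ => ?_⟩
    exact ⟨A, mem_calM_of_Sol ⟨hdet, h⟩, b, Filter.Eventually.of_forall fun _ => rfl⟩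
  · set G := A * Q with hG
    have hs : 0 ≤ G 0 1 ^ 2 + G 1 1 ^ 2 := by positivity
    let k : NNReal := ⟨G 0 1 ^ 2 + G 1 1 ^ 2 + 1, by positivity⟩
    have hK : KK k G := ⟨hdet, h, by
      change _ < (G 0 1 ^ 2 + G 1 1 ^ 2 + 1) ^ 2
      nlinarith⟩
    have hcont : Continuous fun z : E2 => Q *ᵥ z := by fun_prop
    have hO : IsOpen ((fun z : E2 => Q *ᵥ z) ⁻¹' V) := hV.preimage hcont
    have hQdet : LinearMap.det (Matrix.toLin' Q) ≠ 0 := by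
      rw [LinearMap.det_toLin']
      intro h
      have := congrArg Matrix.det q2
      simp [h] at this
    have hOf : volume ((fun z : E2 => Q *ᵥ z) ⁻¹' V) ≠ ⊤ := by
      have := Measure.addHaar_preimage_linearMap (volume : Measure E2) hQdet V
      have h2 : volume ((Matrix.toLin' Q) ⁻¹' V) ≠ ⊤ := by
        rw [this]
        exact ENNReal.mul_ne_top ENNReal.ofReal_ne_top hVf
      exact h2
    obtain ⟨w, hw1, hw2, hw3⟩ := main_strict hK b hO hOf
    obtain ⟨L, hL⟩ := aff_lip_any Qᵀ 0
    have hQQ : ∀ x : E2, Q *ᵥ (Qᵀ *ᵥ x) = x := fun x => by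
      rw [Matrix.mulVec_mulVec, q1, Matrix.one_mulVec]
    refine ⟨(k + 6) * L, fun x => w (Qᵀ *ᵥ x), ?_, ?_, ?_⟩
    · have := hw1.comp hL
      simpa [Function.comp_def] using this
    · intro x hx
      change w (Qᵀ *ᵥ x) = _
      rw [hw2 _ (by rwa [Set.mem_preimage, hQQ]), hG, Matrix.mulVec_mulVec, Matrix.mul_assoc, q1,
        Matrix.mul_one]
    · filter_upwards [ae_lin (R := Qᵀ) q1 hw3] with x hx hxV
      have := hx (by rwa [Set.mem_preimage, hQQ])
      refine this.lin.mono ?_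
      rintro G' ⟨G0, hS, rfl⟩
      rw [Matrix.mul_assoc, q2, Matrix.mul_one]
      exact mem_calM_of_Sol hS


/-- From a continuous finitely piecewise affine solution of the relaxed inclusion
(∇v Qᵢ ∈ 𝓝 on each piece) one obtains a Lipschitz solution of the unrelaxed inclusion
(Du Qᵢ ∈ 𝓜 a.e. on each piece) with the same affine boundary values. -/
theorem stmt18 (Ω : Set (Fin 2 → ℝ)) (hΩo : IsOpen Ω) (hΩb : Bornology.IsBounded Ω)
    (F : M2) (m : ℕ) (V : Fin m → Set (Fin 2 → ℝ))
    (hVo : ∀ i, IsOpen (V i)) (hVsub : ∀ i, V i ⊆ Ω)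
    (hVdisj : ∀ i j, i ≠ j → Disjoint (V i) (V j))
    (hfull : volume (Ω \ ⋃ i, V i) = 0)
    (Q : Fin m → M2) (hQ : ∀ i, Q i ∈ SO2)
    (v : (Fin 2 → ℝ) → Fin 2 → ℝ) (hv : ContinuousOn v (closure Ω))
    (hvbd : ∀ x ∈ frontier Ω, v x = F.mulVec x)
    (A : Fin m → M2) (b : Fin m → Fin 2 → ℝ)
    (haff : ∀ i, ∀ x ∈ V i, v x = (A i).mulVec x + b i)
    (hAQ : ∀ i, A i * Q i ∈ calN e1) :
    ∃ (u : (Fin 2 → ℝ) → Fin 2 → ℝ) (K : NNReal),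
      LipschitzOnWith K u (closure Ω) ∧
      (∀ x ∈ frontier Ω, u x = F.mulVec x) ∧
      ∀ i, ∀ᵐ x ∂(volume : Measure (Fin 2 → ℝ)), x ∈ V i →
        DifferentiableAt ℝ u x ∧ gradMatrix u x * Q i ∈ calM e1 := by
  classical
  have hVf : ∀ i, volume (V i) ≠ ⊤ := fun i => (hΩb.subset (hVsub i)).measure_lt_top.ne
  choose L w hwL hwo hwae using fun i => piece (hVo i) (hVf i) (hQ i) (hAQ i) (b i)
  let vt : E2 → E2 := (closure Ω).piecewise v (fun x => F *ᵥ x)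
  have hvt1 : ∀ x ∈ closure Ω, vt x = v x := fun x hx => Set.piecewise_eq_of_mem _ _ _ hx
  have hvt2 : ∀ x, x ∉ Ω → vt x = F *ᵥ x := by
    intro x hx
    by_cases h : x ∈ closure Ω
    · rw [hvt1 x h]
      exact hvbd x ⟨h, by rwa [hΩo.interior_eq]⟩
    · exact Set.piecewise_eq_of_notMem _ _ _ h
  have hvtc : Continuous vt := by
    refine continuous_piecewise ?_ ?_ ?_
    · intro x hx
      exact hvbd x (frontier_closure_subset hx)
    · rwa [closure_closure]
    · exact Continuous.continuousOn (by fun_prop)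
  have hcl : ∀ i, ∀ x ∈ closure (V i), vt x = A i *ᵥ x + b i := by
    intro i
    have hc : IsClosed {x : E2 | vt x = A i *ᵥ x + b i} := isClosed_eq hvtc (by fun_prop)
    have hs : V i ⊆ {x : E2 | vt x = A i *ᵥ x + b i} := by
      intro x hx
      change vt x = _
      rw [hvt1 x (subset_closure (hVsub i hx)), haff i x hx]
    exact fun x hx => (closure_minimal hs hc) hx
  have hdense : ∀ x ∈ Ω, ∃ i, x ∈ closure (V i) := by
    intro x hx
    by_contra hcon
    push Not at hcon
    have ho : IsOpen (Ω ∩ (⋃ i, closure (V i))ᶜ) :=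
      hΩo.inter (isClosed_iUnion_of_finite fun i => isClosed_closure).isOpen_compl
    have h0 : volume (Ω ∩ (⋃ i, closure (V i))ᶜ) = 0 := by
      refine measure_mono_null ?_ hfull
      rintro y ⟨h1, h2⟩
      refine ⟨h1, fun h3 => h2 ?_⟩
      obtain ⟨i, hi⟩ := Set.mem_iUnion.1 h3
      exact Set.mem_iUnion.2 ⟨i, subset_closure hi⟩
    have he := (ho.measure_eq_zero_iff volume).1 h0
    have : x ∈ Ω ∩ (⋃ i, closure (V i))ᶜ :=
      ⟨hx, fun h => by obtain ⟨i, hi⟩ := Set.mem_iUnion.1 h; exact hcon i hi⟩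
    rw [he] at this
    exact this
  choose La hLa using fun i => aff_lip_any (A i) (b i)
  obtain ⟨LF, hLF⟩ := aff_lip_any F 0
  let K : NNReal := LF + ∑ i, La i + ∑ i, L i
  have hK1 : LF ≤ K := by
    change LF ≤ LF + ∑ i, La i + ∑ i, L i
    rw [add_assoc]
    exact le_self_add
  have hK2 : ∀ i, La i ≤ K := fun i =>
    ((Finset.single_le_sum (f := La) (fun _ _ => zero_le) (Finset.mem_univ i)).trans
      le_add_self).trans le_self_add
  have hK3 : ∀ i, L i ≤ K := fun i =>
    (Finset.single_le_sum (f := L) (fun _ _ => zero_le) (Finset.mem_univ i)).trans le_add_self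
  have hvtL : LipschitzWith K vt := by
    refine selection_lipschitz (ι := Option (Fin m)) K
      (fun o => o.elim (fun x => F *ᵥ x + 0) (fun i x => A i *ᵥ x + b i)) ?_ vt hvtc ?_
    · rintro (_ | i)
      · exact hLF.weaken hK1
      · exact (hLa i).weaken (hK2 i)
    · intro x
      by_cases hx : x ∈ Ω
      · obtain ⟨i, hi⟩ := hdense x hx
        exact ⟨some i, hcl i x hi⟩
      · exact ⟨none, by simpa using hvt2 x hx⟩
  let u : E2 → E2 := fun x => if h : ∃ i, x ∈ V i then w h.choose x else vt x
  have hu1 : ∀ i, ∀ x ∈ V i, u x = w i x := by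
    intro i x hx
    have h : ∃ i, x ∈ V i := ⟨i, hx⟩
    have he : h.choose = i := by
      by_contra hne
      exact Set.disjoint_left.1 (hVdisj _ _ hne) h.choose_spec hx
    change (if h : ∃ i, x ∈ V i then w h.choose x else vt x) = _
    rw [dif_pos h, he]
  have hu2 : ∀ x, (∀ i, x ∉ V i) → u x = vt x := by
    intro x hx
    exact dif_neg (by push Not; exact hx)
  have huL : LipschitzWith K u := by
    refine glue_lipschitz V hVo hVdisj K vt hvtL w (fun i => (hwL i).weaken (hK3 i)) ?_ u hu1 hu2
    intro i x hx
    rw [hcl i x hx.1]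
    refine hwo i x ?_
    have := hx.2
    rwa [(hVo i).interior_eq] at this
  refine ⟨u, K, huL.lipschitzOnWith, ?_, ?_⟩
  · intro x hx
    have hxΩ : x ∉ Ω := by
      have := hx.2
      rwa [hΩo.interior_eq] at this
    rw [hu2 x fun i hi => hxΩ (hVsub i hi)]
    exact hvt2 x hxΩ
  · intro i
    filter_upwards [hwae i] with x hx hxV
    refine LocAff.diff (P := fun G => G * Q i ∈ calM e1) ((hx hxV).congr ?_)
    filter_upwards [(hVo i).mem_nhds hxV] with y hy
    exact hu1 i y hy
end
end
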